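/- arXiv:1909.11546 — 8 statements merged into one kernel-verified Lean document; each statement's English description precedes it below -/
import Mathlib

section
/- Fix an integer k ≥ 1 and consider the fair k-sided positive-step die with face values 1, 2, …, k, each with probability 1/k; let E(n) and V(n) be the expectation and variance of the duration until the running total first reaches ≥ n. Then V(n) − ( 2(k−1)·n/(3(k+1)²) + 2(k−1)²/(9(k+1)²) ) tends to 0 as n → ∞. -/
/-- The sum of the first `j` steps of the word `w` (face values given by `v`). -/
def prefSumN {s k : ℕ} (v : Fin s → ℕ) (w : Fin k → Fin s) (j : ℕ) : ℕ :=
  ∑ i ∈ Finset.univ.filter (fun i : Fin k => (i : ℕ) < j), v (w i)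

/-- The first-passage probability `P_n(k')`: the probability that the running total of
rolls of the die (face values `v`, probabilities `p`) first reaches `≥ n` at exactly
roll `k'`. -/
noncomputable def firstPassage {s : ℕ} (v : Fin s → ℕ) (p : Fin s → ℝ) (n k : ℕ) : ℝ :=
  ∑ w ∈ Finset.univ.filter (fun w : Fin k → Fin s =>
      n ≤ prefSumN v w k ∧ ∀ j : ℕ, j < k → prefSumN v w j < n),
    ∏ i : Fin k, p (w i)

/-- The expected duration `E(n) = Σ_{k'=1}^n k' · P_n(k')` until first reaching `≥ n`. -/
noncomputable def expDur {s : ℕ} (v : Fin s → ℕ) (p : Fin s → ℝ) (n : ℕ) : ℝ :=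
  ∑ k ∈ Finset.Icc 1 n, (k : ℝ) * firstPassage v p n k

/-- The variance `V(n) = Σ_{k'=1}^n k'² · P_n(k') − E(n)²` of the duration. -/
noncomputable def varDur {s : ℕ} (v : Fin s → ℕ) (p : Fin s → ℝ) (n : ℕ) : ℝ :=
  (∑ k ∈ Finset.Icc 1 n, (k : ℝ) ^ 2 * firstPassage v p n k) - (expDur v p n) ^ 2

open Filter Topology Finset

section FirstPassage

variable {s : ℕ} (v : Fin s → ℕ) (p : Fin s → ℝ)

lemma prefSumN_zero {k : ℕ} (w : Fin k → Fin s) : prefSumN v w 0 = 0 := by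
  simp [prefSumN]

lemma prefSumN_cons_succ {k : ℕ} (c : Fin s) (w : Fin k → Fin s) (j : ℕ) :
    prefSumN v (Fin.cons c w : Fin (k + 1) → Fin s) (j + 1) = v c + prefSumN v w j := by
  simp [prefSumN, Finset.sum_filter, Fin.sum_univ_succ]

lemma firstPassage_zero_zero : firstPassage v p 0 0 = 1 := by
  simp [firstPassage]

lemma firstPassage_zero_succ (k : ℕ) : firstPassage v p 0 (k + 1) = 0 := by
  unfold firstPassage
  rw [Finset.filter_false_of_mem, Finset.sum_empty]
  rintro w - ⟨-, h⟩
  exact absurd (h 0 k.succ_pos) (Nat.not_lt_zero _)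

lemma firstPassage_succ_zero (n : ℕ) : firstPassage v p (n + 1) 0 = 0 := by
  unfold firstPassage
  rw [Finset.filter_false_of_mem, Finset.sum_empty]
  rintro w - ⟨h, -⟩
  rw [prefSumN_zero] at h
  omega

/-- Conditioning on the first roll. -/
lemma firstPassage_succ_succ (n k : ℕ) :
    firstPassage v p (n + 1) (k + 1) = ∑ c, p c * firstPassage v p (n + 1 - v c) k := by
  unfold firstPassage
  simp only [Finset.sum_filter]
  rw [← (Fin.consEquiv fun _ : Fin (k + 1) => Fin s).sum_comp, Fintype.sum_prod_type]
  refine Finset.sum_congr rfl fun c _ => ?_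
  rw [Finset.mul_sum]
  refine Finset.sum_congr rfl fun w _ => ?_
  have hiff : (n + 1 ≤ prefSumN v (Fin.cons c w : Fin (k + 1) → Fin s) (k + 1) ∧
      ∀ j < k + 1, prefSumN v (Fin.cons c w : Fin (k + 1) → Fin s) j < n + 1) ↔
      (n + 1 - v c ≤ prefSumN v w k ∧ ∀ j < k, prefSumN v w j < n + 1 - v c) := by
    rw [prefSumN_cons_succ]
    refine and_congr (by omega) ⟨fun h j hj => ?_, fun h j hj => ?_⟩
    · have := h (j + 1) (by omega)
      rw [prefSumN_cons_succ] at this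
      omega
    · cases j with
      | zero => rw [prefSumN_zero]; omega
      | succ j =>
        rw [prefSumN_cons_succ]
        have := h j (by omega)
        omega
  simp only [Fin.consEquiv, Equiv.coe_fn_mk, hiff, Fin.prod_univ_succ, Fin.cons_zero,
    Fin.cons_succ, mul_ite, mul_zero]

lemma firstPassage_eq_zero_of_lt (hv : ∀ c, 1 ≤ v c) {n k : ℕ} (h : n < k) :
    firstPassage v p n k = 0 := by
  induction k generalizing n with
  | zero => omega
  | succ k ih =>
    cases n with
    | zero => exact firstPassage_zero_succ v p k
    | succ n =>
      rw [firstPassage_succ_succ]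
      refine Finset.sum_eq_zero fun c _ => ?_
      rw [ih (by have := hv c; omega), mul_zero]

/-- The expectation of `f` applied to the duration for the goal `n`. -/
noncomputable def durMean (f : ℕ → ℝ) (n : ℕ) : ℝ :=
  ∑ k ∈ range (n + 1), f k * firstPassage v p n k

lemma durMean_eq_sum_range (hv : ∀ c, 1 ≤ v c) (f : ℕ → ℝ) {n N : ℕ} (h : n ≤ N) :
    durMean v p f n = ∑ k ∈ range (N + 1), f k * firstPassage v p n k := by
  refine Finset.sum_subset (by simpa using h) fun k _ hk => ?_
  rw [firstPassage_eq_zero_of_lt v p hv (by simpa using hk), mul_zero]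

lemma durMean_zero (f : ℕ → ℝ) : durMean v p f 0 = f 0 := by
  simp [durMean, firstPassage_zero_zero]

lemma durMean_succ (hv : ∀ c, 1 ≤ v c) (f : ℕ → ℝ) (n : ℕ) :
    durMean v p f (n + 1) = ∑ c, p c * durMean v p (fun k => f (k + 1)) (n + 1 - v c) := by
  rw [durMean, Finset.sum_range_succ', firstPassage_succ_zero, mul_zero, add_zero]
  simp only [firstPassage_succ_succ, Finset.mul_sum]
  rw [Finset.sum_comm]
  refine Finset.sum_congr rfl fun c _ => ?_
  rw [durMean_eq_sum_range v p hv _ (show n + 1 - v c ≤ n by have := hv c; omega),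
    Finset.mul_sum]
  exact Finset.sum_congr rfl fun k _ => by ring

lemma durMean_one (hv : ∀ c, 1 ≤ v c) (hp : ∑ c, p c = 1) (n : ℕ) :
    durMean v p (fun _ => 1) n = 1 := by
  induction n using Nat.strong_induction_on with
  | _ n ih =>
    cases n with
    | zero => exact durMean_zero v p _
    | succ n =>
      rw [durMean_succ v p hv]
      refine (Finset.sum_congr rfl fun c _ => ?_).trans hp
      rw [ih _ (by have := hv c; omega), mul_one]

lemma durMean_eq_sum_Icc (f : ℕ → ℝ) (hf : f 0 = 0) (n : ℕ) :
    durMean v p f n = ∑ k ∈ Icc 1 n, f k * firstPassage v p n k := by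
  refine (Finset.sum_subset (fun k hk => ?_) fun k hk hk' => ?_).symm
  · simp at hk ⊢; omega
  · have : k = 0 := by simp at hk hk'; omega
    rw [this, hf, zero_mul]

lemma expDur_eq_durMean (n : ℕ) : expDur v p n = durMean v p (fun k => (k : ℝ)) n :=
  (durMean_eq_sum_Icc v p _ (by simp) n).symm

lemma varDur_eq_durMean (n : ℕ) :
    varDur v p n =
      durMean v p (fun k => (k : ℝ) ^ 2) n - durMean v p (fun k => (k : ℝ)) n ^ 2 := by
  rw [varDur, expDur_eq_durMean, durMean_eq_sum_Icc v p (fun k => (k : ℝ) ^ 2) (by simp)]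

lemma durMean_id_succ (hv : ∀ c, 1 ≤ v c) (hp : ∑ c, p c = 1) (n : ℕ) :
    durMean v p (fun k => (k : ℝ)) (n + 1) =
      1 + ∑ c, p c * durMean v p (fun k => (k : ℝ)) (n + 1 - v c) := by
  rw [durMean_succ v p hv, ← hp, ← Finset.sum_add_distrib]
  refine Finset.sum_congr rfl fun c _ => ?_
  have h : durMean v p (fun k => ((k + 1 : ℕ) : ℝ)) (n + 1 - v c) =
      durMean v p (fun k => (k : ℝ)) (n + 1 - v c) + durMean v p (fun _ => 1) (n + 1 - v c) := by
    simp only [durMean, ← Finset.sum_add_distrib]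
    exact Finset.sum_congr rfl fun k _ => by push_cast; ring
  rw [h, durMean_one v p hv hp]
  ring

lemma durMean_sq_succ (hv : ∀ c, 1 ≤ v c) (hp : ∑ c, p c = 1) (n : ℕ) :
    durMean v p (fun k => (k : ℝ) ^ 2) (n + 1) =
      2 * durMean v p (fun k => (k : ℝ)) (n + 1) - 1 +
        ∑ c, p c * durMean v p (fun k => (k : ℝ) ^ 2) (n + 1 - v c) := by
  have key : durMean v p (fun k => (k : ℝ) ^ 2) (n + 1) =
      ∑ c, (p c * durMean v p (fun k => (k : ℝ) ^ 2) (n + 1 - v c) +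
        2 * (p c * durMean v p (fun k => (k : ℝ)) (n + 1 - v c)) + p c) := by
    rw [durMean_succ v p hv]
    refine Finset.sum_congr rfl fun c _ => ?_
    have h : durMean v p (fun k => ((k + 1 : ℕ) : ℝ) ^ 2) (n + 1 - v c) =
        durMean v p (fun k => (k : ℝ) ^ 2) (n + 1 - v c) +
        2 * durMean v p (fun k => (k : ℝ)) (n + 1 - v c) +
        durMean v p (fun _ => 1) (n + 1 - v c) := by
      simp only [durMean, Finset.mul_sum, ← Finset.sum_add_distrib]
      exact Finset.sum_congr rfl fun k _ => by push_cast; ring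
    rw [h, durMean_one v p hv hp]
    ring
  rw [key, durMean_id_succ v p hv hp, Finset.sum_add_distrib, Finset.sum_add_distrib,
    ← Finset.mul_sum, hp]
  ring

end FirstPassage

section RampSum

lemma sum_range_cubic (c₀ c₁ c₂ c₃ : ℝ) (k : ℕ) :
    ∑ j ∈ range k, (c₀ + c₁ * (j : ℝ) + c₂ * (j : ℝ) ^ 2 + c₃ * (j : ℝ) ^ 3) =
      c₀ * k + c₁ * (k * (k - 1) / 2) + c₂ * (k * (k - 1) * (2 * k - 1) / 6) +
        c₃ * (k ^ 2 * (k - 1) ^ 2 / 4) := by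
  induction k with
  | zero => simp
  | succ k ih => rw [Finset.sum_range_succ, ih]; push_cast; ring

/-- The sum of the window of length `k` starting at `i`, with linearly increasing weights. -/
noncomputable def rampSum (k : ℕ) (u : ℕ → ℝ) (i : ℕ) : ℝ :=
  ∑ j ∈ range k, ((j : ℝ) + 1) * u (i + j)

lemma rampSum_succ (k : ℕ) (u : ℕ → ℝ) (i : ℕ) :
    rampSum k u (i + 1) = rampSum k u i + (k * u (i + k) - ∑ j ∈ range k, u (i + j)) := by
  have h1 := Finset.sum_range_succ (fun j : ℕ => (j : ℝ) * u (i + j)) k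
  rw [Finset.sum_range_succ'] at h1
  have h2 : rampSum k u (i + 1) = ∑ j ∈ range k, ((j + 1 : ℕ) : ℝ) * u (i + (j + 1)) :=
    Finset.sum_congr rfl fun j _ => by push_cast; congr 2; omega
  have h3 : rampSum k u i = ∑ j ∈ range k, (j : ℝ) * u (i + j) + ∑ j ∈ range k, u (i + j) := by
    rw [rampSum, ← Finset.sum_add_distrib]
    exact Finset.sum_congr rfl fun j _ => by ring
  simp only [Nat.cast_zero, zero_mul, add_zero] at h1
  rw [h2, h3, h1]
  ring

/-- An approximate moving average contracts the oscillation on windows of length `k`. -/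
lemma window_contraction {k : ℕ} (hk : 1 ≤ k) {u : ℕ → ℝ} {δ : ℝ} {N : ℕ}
    (hδ : ∀ i ≥ N, |k * u (i + k) - ∑ j ∈ range k, u (i + j)| ≤ k * δ)
    {i : ℕ} (hi : N ≤ i) {m D : ℝ} (hD : ∀ j < k, m ≤ u (i + j) ∧ u (i + j) ≤ m + D) :
    ∃ m', ∀ j < k, m' ≤ u (i + k + j) ∧
      u (i + k + j) ≤ m' + ((1 - 1 / k) * D + 2 * k * δ) := by
  have hK : (1 : ℝ) ≤ k := by exact_mod_cast hk
  have hδ0 : 0 ≤ δ := by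
    have := (abs_nonneg _).trans (hδ N le_rfl)
    exact nonneg_of_mul_nonneg_right this (by linarith)
  set c := u (i + (k - 1)) with hc
  obtain ⟨hcm, hcM⟩ := hD (k - 1) (by omega)
  rw [← hc] at hcm hcM
  have key : ∀ t < k, m + (c - m) / k - (t + 1) * δ ≤ u (i + k + t) ∧
      u (i + k + t) ≤ m + D - (m + D - c) / k + (t + 1) * δ := by
    intro t
    induction t using Nat.strong_induction_on with
    | _ t ih =>
      intro ht
      have hwin : ∀ j < k, m - t * δ ≤ u (i + t + j) ∧ u (i + t + j) ≤ m + D + t * δ := by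
        intro j hj
        rcases lt_or_ge (t + j) k with h | h
        · have := hD (t + j) h
          rw [← add_assoc] at this
          have h0 : 0 ≤ (t : ℝ) * δ := by positivity
          constructor <;> linarith [this.1, this.2]
        · obtain ⟨r, hr⟩ := Nat.exists_eq_add_of_le h
          have h1 := ih r (by omega) (by omega)
          rw [show i + t + j = i + k + r by omega]
          have hrt : ((r : ℝ) + 1) * δ ≤ t * δ := by
            refine mul_le_mul_of_nonneg_right ?_ hδ0
            exact_mod_cast (by omega : r + 1 ≤ t)
          have h2 : 0 ≤ (c - m) / k := div_nonneg (by linarith) (by linarith)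
          have h3 : 0 ≤ (m + D - c) / k := div_nonneg (by linarith) (by linarith)
          constructor <;> linarith [h1.1, h1.2]
      have hmem : k - 1 - t ∈ range k := by simp; omega
      have hidx : u (i + t + (k - 1 - t)) = c := by rw [hc]; congr 1; omega
      have hcard : (((range k).erase (k - 1 - t)).card : ℝ) = k - 1 := by
        rw [Finset.card_erase_of_mem hmem, card_range]
        push_cast [hk]
        ring
      have hsum := Finset.add_sum_erase (range k) (fun j => u (i + t + j)) hmem
      simp only [hidx] at hsum
      have hlo : (k - 1) * (m - t * δ) ≤ ∑ j ∈ (range k).erase (k - 1 - t), u (i + t + j) := by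
        rw [← hcard, ← nsmul_eq_mul]
        exact Finset.card_nsmul_le_sum _ _ _ fun j hj =>
          (hwin j (by simpa using Finset.mem_of_mem_erase hj)).1
      have hup : ∑ j ∈ (range k).erase (k - 1 - t), u (i + t + j) ≤
          (k - 1) * (m + D + t * δ) := by
        rw [← hcard, ← nsmul_eq_mul]
        exact Finset.sum_le_card_nsmul _ _ _ fun j hj =>
          (hwin j (by simpa using Finset.mem_of_mem_erase hj)).2
      have habs := abs_le.1 (hδ (i + t) (by omega))
      rw [show i + t + k = i + k + t by omega, ← hsum] at habs
      have h0 : 0 ≤ (t : ℝ) * δ := by positivity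
      have hk0 : (0 : ℝ) < k := by linarith
      constructor
      · refine le_of_mul_le_mul_left ?_ hk0
        have : (k : ℝ) * (m + (c - m) / k - (t + 1) * δ) =
            k * m + (c - m) - k * (t * δ) - k * δ := by field_simp; ring
        rw [this]
        linarith [habs.1, habs.2]
      · refine le_of_mul_le_mul_left ?_ hk0
        have : (k : ℝ) * (m + D - (m + D - c) / k + (t + 1) * δ) =
            k * (m + D) - (m + D - c) + k * (t * δ) + k * δ := by field_simp; ring
        rw [this]
        linarith [habs.1, habs.2]
  refine ⟨m + (c - m) / k - k * δ, fun j hj => ?_⟩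
  have hjk : ((j : ℝ) + 1) * δ ≤ k * δ :=
    mul_le_mul_of_nonneg_right (by exact_mod_cast hj) hδ0
  obtain ⟨h1, h2⟩ := key j hj
  refine ⟨by linarith, h2.trans ?_⟩
  have : m + D - (m + D - c) / k = m + (c - m) / k + (1 - 1 / k) * D := by
    field_simp; ring
  rw [this]
  linarith

lemma abs_le_add_abs_rampSum {k : ℕ} {u : ℕ → ℝ} {i : ℕ} {m D : ℝ}
    (hD : ∀ j < k, m ≤ u (i + j) ∧ u (i + j) ≤ m + D) {j : ℕ} (hj : j < k) :
    |u (i + j)| ≤ D + |rampSum k u i| := by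
  set K : ℝ := ∑ l ∈ range k, ((l : ℝ) + 1) with hKdef
  have hK : 1 ≤ K := by
    have : ((0 : ℕ) : ℝ) + 1 ≤ K :=
      Finset.single_le_sum (f := fun l : ℕ => (l : ℝ) + 1) (fun l _ => by positivity)
        (by simp; omega)
    simpa using this
  have hlo : K * m ≤ rampSum k u i := by
    rw [hKdef, Finset.sum_mul]
    exact Finset.sum_le_sum fun l hl =>
      mul_le_mul_of_nonneg_left (hD l (by simpa using hl)).1 (by positivity)
  have hup : rampSum k u i ≤ K * (m + D) := by
    rw [hKdef, Finset.sum_mul]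
    exact Finset.sum_le_sum fun l hl =>
      mul_le_mul_of_nonneg_left (hD l (by simpa using hl)).2 (by positivity)
  obtain ⟨h1, h2⟩ := hD j hj
  have hR := abs_nonneg (rampSum k u i)
  have hm : m ≤ |rampSum k u i| := by
    by_contra! h
    nlinarith [le_abs_self (rampSum k u i)]
  have hM : -|rampSum k u i| ≤ m + D := by
    by_contra! h
    nlinarith [neg_abs_le (rampSum k u i)]
  rw [abs_le]
  constructor <;> linarith

theorem tendsto_zero_of_rampSum {k : ℕ} (hk : 1 ≤ k) {u : ℕ → ℝ}
    (h : Tendsto (rampSum k u) atTop (𝓝 0)) : Tendsto u atTop (𝓝 0) := by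
  have hK : (1 : ℝ) ≤ k := by exact_mod_cast hk
  have hf : Tendsto (fun i => k * u (i + k) - ∑ j ∈ range k, u (i + j)) atTop (𝓝 0) := by
    have := ((tendsto_add_atTop_iff_nat 1).2 h).sub h
    rw [sub_zero] at this
    exact this.congr fun i => by rw [rampSum_succ]; ring
  rw [Metric.tendsto_atTop]
  intro ε hε
  set δ : ℝ := ε / (8 * k ^ 2) with hδdef
  have hδ : 0 < δ := by positivity
  obtain ⟨N₁, hN₁⟩ := Metric.tendsto_atTop.1 hf (k * δ) (by positivity)
  obtain ⟨N₂, hN₂⟩ := Metric.tendsto_atTop.1 h (ε / 4) (by positivity)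
  set N := max N₁ N₂
  have hfN : ∀ i ≥ N, |k * u (i + k) - ∑ j ∈ range k, u (i + j)| ≤ k * δ := fun i hi => by
    have := hN₁ i ((le_max_left _ _).trans hi)
    rw [Real.dist_eq, sub_zero] at this
    exact this.le
  set B : ℝ := ∑ j ∈ range k, |u (N + j)|
  have hB : ∀ j < k, |u (N + j)| ≤ B := fun j hj =>
    Finset.single_le_sum (f := fun j => |u (N + j)|) (fun _ _ => abs_nonneg _) (by simpa using hj)
  have hwin : ∀ n : ℕ, ∃ m, ∀ j < k, m ≤ u (N + n * k + j) ∧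
      u (N + n * k + j) ≤ m + ((1 - 1 / k) ^ n * (2 * B) + 2 * k ^ 2 * δ) := by
    intro n
    induction n with
    | zero =>
      refine ⟨-B, fun j hj => ?_⟩
      have := abs_le.1 (hB j hj)
      have h0 : 0 ≤ 2 * (k : ℝ) ^ 2 * δ := by positivity
      rw [zero_mul, add_zero, pow_zero]
      constructor <;> linarith [this.1, this.2]
    | succ n ih =>
      obtain ⟨m, hm⟩ := ih
      obtain ⟨m', hm'⟩ := window_contraction hk hfN (Nat.le_add_right N (n * k)) hm
      refine ⟨m', fun j hj => ?_⟩
      have := hm' j hj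
      rw [show N + (n + 1) * k + j = N + n * k + k + j by ring]
      refine ⟨this.1, this.2.trans (le_of_eq ?_)⟩
      have hpow : (1 - 1 / (k : ℝ)) ^ (n + 1) = (1 - 1 / k) ^ n * (1 - 1 / k) := pow_succ _ _
      have hinv : (1 / (k : ℝ)) * k = 1 := one_div_mul_cancel (by linarith)
      rw [hpow]
      linear_combination (-2 * k * δ) * hinv
  have hq : Tendsto (fun n : ℕ => (1 - 1 / (k : ℝ)) ^ n * (2 * B)) atTop (𝓝 0) := by
    have h1 : 1 / (k : ℝ) ≤ 1 := by rw [div_le_one (by linarith)]; exact hK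
    have h2 : 0 < 1 / (k : ℝ) := by positivity
    simpa using (tendsto_pow_atTop_nhds_zero_of_lt_one (by linarith : 0 ≤ 1 - 1 / (k : ℝ))
      (by linarith)).mul_const (2 * B)
  obtain ⟨n₀, hn₀⟩ := Metric.tendsto_atTop.1 hq (ε / 4) (by positivity)
  refine ⟨N + n₀ * k, fun l hl => ?_⟩
  obtain ⟨r, rfl⟩ := Nat.exists_eq_add_of_le (show N ≤ l by nlinarith)
  have hr : n₀ ≤ r / k := (Nat.le_div_iff_mul_le hk).2 (by omega)
  obtain ⟨m, hm⟩ := hwin (r / k)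
  have hu := abs_le_add_abs_rampSum hm (Nat.mod_lt r hk)
  rw [add_assoc, Nat.div_add_mod'] at hu
  have h1 := hn₀ _ hr
  rw [Real.dist_eq, sub_zero] at h1
  have h2 := hN₂ (N + r / k * k) ((le_max_right _ _).trans (Nat.le_add_right _ _))
  rw [Real.dist_eq, sub_zero] at h2
  have h3 : 2 * (k : ℝ) ^ 2 * δ = ε / 4 := by rw [hδdef]; field_simp; ring
  rw [Real.dist_eq, sub_zero]
  linarith [le_abs_self ((1 - 1 / (k : ℝ)) ^ (r / k) * (2 * B))]

end RampSum

/-- A moving-average recursion for the fair die, reindexed so that the `k` values at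
nonpositive goals come first. -/
lemma fair_die_window {k : ℕ} (hk : 1 ≤ k) (F : ℕ → ℝ) (i : ℕ) :
    k * ∑ c : Fin k, 1 / (k : ℝ) * F (i + 1 - ((c : ℕ) + 1)) =
      ∑ j ∈ range k, F (i + j - (k - 1)) := by
  have hK : (k : ℝ) ≠ 0 := by positivity
  rw [Finset.mul_sum, ← Finset.sum_range_reflect,
    Fin.sum_univ_eq_sum_range (fun c => (k : ℝ) * (1 / (k : ℝ) * F (i + 1 - (c + 1))))]
  refine Finset.sum_congr rfl fun j hj => ?_
  rw [← mul_assoc, mul_one_div_cancel hK, one_mul]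
  congr 1
  have := Finset.mem_range.1 hj
  omega

/-- Asymptotics of the solution of the moving-average recursions satisfied by the first two
moments of the duration. -/
theorem tendsto_variance_of_recursion {k : ℕ} (hk : 1 ≤ k) {x s : ℕ → ℝ}
    (hx₀ : ∀ j < k, x j = 0) (hs₀ : ∀ j < k, s j = 0)
    (hx : ∀ i, k * x (i + k) = k + ∑ j ∈ range k, x (i + j))
    (hs : ∀ i, k * s (i + k) = k * (2 * x (i + k) - 1) + ∑ j ∈ range k, s (i + j)) :
    Tendsto (fun i : ℕ => s i - x i ^ 2 -
      (2 * ((k : ℝ) - 1) * ((i : ℝ) - (k - 1)) / (3 * ((k : ℝ) + 1) ^ 2) +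
          2 * ((k : ℝ) - 1) ^ 2 / (9 * ((k : ℝ) + 1) ^ 2))) atTop (𝓝 0) := by
  have hk0 : (k : ℝ) ≠ 0 := by positivity
  have hk1 : (k : ℝ) + 1 ≠ 0 := by positivity
  obtain ⟨a, ha⟩ : ∃ a : ℝ, a = 2 / (k + 1) := ⟨_, rfl⟩
  obtain ⟨b, hb⟩ : ∃ b : ℝ, b = -(4 * (k - 1)) / (3 * (k + 1)) := ⟨_, rfl⟩
  obtain ⟨e, he⟩ : ∃ e : ℕ → ℝ, ∀ i, e i = x i - (a * i + b) := ⟨_, fun _ => rfl⟩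
  have he₀ : ∀ j < k, e j = -(a * j + b) := fun j hj => by rw [he, hx₀ j hj, zero_sub]
  have hWe : ∀ i, rampSum k e i = 0 := by
    intro i
    induction i with
    | zero =>
      have : rampSum k e 0 = ∑ j ∈ range k,
          (-b + (-a - b) * (j : ℝ) + (-a) * (j : ℝ) ^ 2 + 0 * (j : ℝ) ^ 3) :=
        Finset.sum_congr rfl fun j hj => by
          rw [zero_add, he₀ j (by simpa using hj)]; ring
      rw [this, sum_range_cubic, ha, hb]
      field_simp
      ring
    | succ i ih =>
      have : ∑ j ∈ range k, e (i + j) = ∑ j ∈ range k, x (i + j) - ∑ j ∈ range k,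
          ((a * i + b) + a * (j : ℝ) + 0 * (j : ℝ) ^ 2 + 0 * (j : ℝ) ^ 3) := by
        rw [← Finset.sum_sub_distrib]
        exact Finset.sum_congr rfl fun j _ => by rw [he]; push_cast; ring
      rw [rampSum_succ, ih, this, sum_range_cubic, he, mul_sub, hx, ha]
      push_cast
      field_simp
      ring
  have he_lim : Tendsto e atTop (𝓝 0) :=
    tendsto_zero_of_rampSum hk (by rw [funext hWe]; exact tendsto_const_nhds)
  have hie_lim : Tendsto (fun i : ℕ => (i : ℝ) * e i) atTop (𝓝 0) := by
    refine tendsto_zero_of_rampSum hk ?_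
    have h1 : ∀ i, rampSum k (fun i : ℕ => (i : ℝ) * e i) i =
        ∑ j ∈ range k, (((j : ℝ) + 1) * j) * e (i + j) := by
      intro i
      have h2 : rampSum k (fun i : ℕ => (i : ℝ) * e i) i = i * rampSum k e i +
          ∑ j ∈ range k, (((j : ℝ) + 1) * j) * e (i + j) := by
        rw [rampSum, rampSum, Finset.mul_sum, ← Finset.sum_add_distrib]
        exact Finset.sum_congr rfl fun j _ => by push_cast; ring
      rw [h2, hWe, mul_zero, zero_add]
    rw [funext h1]
    have h3 := tendsto_finsetSum (range k) fun j _ =>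
      ((tendsto_add_atTop_iff_nat j).2 he_lim).const_mul (((j : ℝ) + 1) * j)
    simpa using h3
  obtain ⟨y, hy⟩ : ∃ y : ℕ → ℝ, ∀ i, y i = ∑ l ∈ range i, e l := ⟨_, fun _ => rfl⟩
  have hy_succ : ∀ i, y (i + 1) = y i + e i := fun i => by
    rw [hy, hy, Finset.sum_range_succ]
  have hy₀ : ∀ j ≤ k, y j = -(a * (j * (j - 1) / 2) + b * j) := by
    intro j hj
    induction j with
    | zero => simp [hy]
    | succ j ih => rw [hy_succ, ih (by omega), he₀ j (by omega)]; push_cast; ring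
  obtain ⟨c, hc⟩ : ∃ c : ℝ, c = rampSum k y 0 / (k * (k + 1) / 2) := ⟨_, rfl⟩
  have hy_lim : Tendsto y atTop (𝓝 c) := by
    rw [← tendsto_sub_nhds_zero_iff]
    refine tendsto_zero_of_rampSum hk ?_
    have hconst : ∀ i, rampSum k (fun i => y i - c) i = 0 := by
      intro i
      induction i with
      | zero =>
        have : rampSum k (fun i => y i - c) 0 = rampSum k y 0 - ∑ j ∈ range k,
            (c + c * (j : ℝ) + 0 * (j : ℝ) ^ 2 + 0 * (j : ℝ) ^ 3) := by
          rw [rampSum, rampSum, ← Finset.sum_sub_distrib]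
          exact Finset.sum_congr rfl fun j _ => by ring
        rw [this, sum_range_cubic, hc]
        field_simp
        ring
      | succ i ih =>
        have : rampSum k (fun i => y i - c) (i + 1) =
            rampSum k (fun i => y i - c) i + rampSum k e i := by
          simp only [rampSum, ← Finset.sum_add_distrib]
          refine Finset.sum_congr rfl fun j _ => ?_
          rw [show i + 1 + j = i + j + 1 by ring, hy_succ]
          ring
        rw [this, ih, hWe, add_zero]
    rw [funext hconst]
    exact tendsto_const_nhds
  have hWy : rampSum k y 0 = ∑ j ∈ range k,
      (0 + (a / 2 - b) * (j : ℝ) + (-b) * (j : ℝ) ^ 2 + (-(a / 2)) * (j : ℝ) ^ 3) :=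
    Finset.sum_congr rfl fun j hj => by
      rw [zero_add, hy₀ j (by simpa using (Finset.mem_range.1 hj).le)]; ring
  obtain ⟨α, hα⟩ : ∃ α : ℝ, α = 2 * (k - 1) / (3 * (k + 1) ^ 2) := ⟨_, rfl⟩
  obtain ⟨β, hβ⟩ : ∃ β : ℝ, β = 2 * ((k : ℝ) - 1) ^ 2 / (9 * (k + 1) ^ 2) - α * (k - 1) :=
    ⟨_, rfl⟩
  obtain ⟨v, hv⟩ : ∃ v : ℕ → ℝ, ∀ i : ℕ, v i = s i - (a * i + b) ^ 2 - (α * i + β) :=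
    ⟨_, fun _ => rfl⟩
  have hWv : ∀ i, rampSum k v i = rampSum k v 0 + 2 * k * (y (i + k) - y k) := by
    intro i
    induction i with
    | zero => rw [zero_add, sub_self, mul_zero, add_zero]
    | succ i ih =>
      have : ∑ j ∈ range k, v (i + j) = ∑ j ∈ range k, s (i + j) - ∑ j ∈ range k,
          (((a * i + b) ^ 2 + α * i + β) + (2 * a * (a * i + b) + α) * (j : ℝ) +
            a ^ 2 * (j : ℝ) ^ 2 + 0 * (j : ℝ) ^ 3) := by
        rw [← Finset.sum_sub_distrib]
        exact Finset.sum_congr rfl fun j _ => by rw [hv]; push_cast; ring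
      have hvk : k * v (i + k) = k * (2 * x (i + k) - 1) + ∑ j ∈ range k, s (i + j) -
          k * ((a * (i + k : ℕ) + b) ^ 2 + (α * (i + k : ℕ) + β)) := by
        rw [hv]
        linear_combination hs i
      rw [rampSum_succ, ih, this, sum_range_cubic, hvk,
        show i + 1 + k = i + k + 1 by ring, hy_succ, he, hα, hb, ha]
      push_cast
      field_simp
      ring
  have hWv₀ : rampSum k v 0 = ∑ j ∈ range k,
      (-(b ^ 2 + β) + (-(2 * a * b + α + b ^ 2 + β)) * (j : ℝ) +
        (-(a ^ 2 + 2 * a * b + α)) * (j : ℝ) ^ 2 + (-a ^ 2) * (j : ℝ) ^ 3) :=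
    Finset.sum_congr rfl fun j hj => by
      rw [zero_add, hv, hs₀ j (by simpa using hj)]; ring
  have hv_lim : Tendsto v atTop (𝓝 0) := by
    refine tendsto_zero_of_rampSum hk ?_
    rw [funext hWv]
    have h1 := ((((tendsto_add_atTop_iff_nat k).2 hy_lim).sub_const (y k)).const_mul
      (2 * (k : ℝ))).const_add (rampSum k v 0)
    convert h1 using 2
    rw [hWv₀, hc, hWy, hy₀ k le_rfl, sum_range_cubic, sum_range_cubic, hβ, hα, hb, ha]
    field_simp
    ring
  have hfin := ((hv_lim.sub (hie_lim.const_mul (2 * a))).sub (he_lim.const_mul (2 * b))).sub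
    (he_lim.pow 2)
  have hzero : (0 : ℝ) - 2 * a * 0 - 2 * b * 0 - 0 ^ 2 = 0 := by ring
  rw [hzero] at hfin
  refine hfin.congr fun i => ?_
  rw [hv, he, hβ, hα]
  ring

/-- For the fair k-sided die with faces 1, …, k each of probability 1/k,
the variance `V(n)` of the duration satisfies
`V(n) − (2(k−1)n/(3(k+1)²) + 2(k−1)²/(9(k+1)²)) → 0` as `n → ∞`. -/
theorem variance_duration_fair_die (k : ℕ) (hk : 1 ≤ k) :
    Filter.Tendsto
      (fun n : ℕ => varDur (fun j : Fin k => (j : ℕ) + 1) (fun _ => 1 / (k : ℝ)) n -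
        (2 * ((k : ℝ) - 1) * (n : ℝ) / (3 * ((k : ℝ) + 1) ^ 2) +
          2 * ((k : ℝ) - 1) ^ 2 / (9 * ((k : ℝ) + 1) ^ 2)))
      Filter.atTop (nhds 0) := by
  have hk0 : (k : ℝ) ≠ 0 := by positivity
  set v : Fin k → ℕ := fun j => (j : ℕ) + 1
  set p : Fin k → ℝ := fun _ => 1 / (k : ℝ)
  have hv : ∀ c, 1 ≤ v c := fun c => Nat.le_add_left _ _
  have hp : ∑ c, p c = 1 := by simp [p, hk0]
  set E := durMean v p fun k => (k : ℝ)
  set S := durMean v p fun k => (k : ℝ) ^ 2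
  have hE : ∀ i, E (i + 1) = 1 + ∑ c : Fin k, 1 / (k : ℝ) * E (i + 1 - ((c : ℕ) + 1)) :=
    durMean_id_succ v p hv hp
  have hS : ∀ i, S (i + 1) = 2 * E (i + 1) - 1 +
      ∑ c : Fin k, 1 / (k : ℝ) * S (i + 1 - ((c : ℕ) + 1)) :=
    durMean_sq_succ v p hv hp
  have hE₀ : E 0 = 0 := by simp [E, durMean_zero]
  have hS₀ : S 0 = 0 := by simp [S, durMean_zero]
  have hidx : ∀ i, i + k - (k - 1) = i + 1 := fun i => by omega
  have key := tendsto_variance_of_recursion hk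
    (x := fun i => E (i - (k - 1))) (s := fun i => S (i - (k - 1)))
    (fun j hj => by rw [show j - (k - 1) = 0 by omega, hE₀])
    (fun j hj => by rw [show j - (k - 1) = 0 by omega, hS₀])
    (fun i => by
      rw [hidx, ← fair_die_window hk E i, hE, mul_add, mul_one])
    (fun i => by
      rw [hidx, ← fair_die_window hk S i, hS, mul_add])
  refine ((tendsto_add_atTop_iff_nat (k - 1)).2 key).congr fun n => ?_
  rw [varDur_eq_durMean, Nat.add_sub_cancel]
  push_cast [hk]
  ring
end

section
/- For n ≥ 1 and k ≥ 1, let N(n,k) be the number of words w ∈ {1,2}^k with w_1 + ⋯ + w_k ≥ n and w_1 + ⋯ + w_j < n for all j < k, and set a(n) = Σ_{k=1}^{n} ( N(n,k)/2^k )² (a rational number). Then a(1) = 1, a(2) = 1/2, a(3) = 5/8, a(4) = 15/32, and for all n ≥ 5: a(n) = (3n−1)(n−3)/(2n(3n−7))·a(n−1) + (21n²−67n+62)/(16n(3n−7))·a(n−2) + (6n²−17n+2)/(16n(3n−7))·a(n−3) − (n−4)(3n−4)/(16n(3n−7))·a(n−4). -/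
/-- `N12 n k` : the number of words `w ∈ {1,2}^k` with `w₁ + ⋯ + w_k ≥ n` and
`w₁ + ⋯ + w_j < n` for all `j < k`. -/
def N12 (n k : ℕ) : ℕ :=
  (Finset.univ.filter (fun w : Fin k → ({1, 2} : Finset ℕ) =>
      n ≤ (∑ i : Fin k, (w i : ℕ)) ∧
      ∀ j : ℕ, j < k →
        (∑ i ∈ Finset.univ.filter (fun i : Fin k => (i : ℕ) < j), (w i : ℕ)) < n)).card

/-- `a(n) = Σ_{k=1}^n (N(n,k)/2^k)²`. -/
def a12 (n : ℕ) : ℚ :=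
  ∑ k ∈ Finset.Icc 1 n, ((N12 n k : ℚ) / 2 ^ k) ^ 2

/-- The number of words `w ∈ {1,2}^k` with `w₁ + ⋯ + w_k = m`, that is, the coefficient of `x ^ m`
in `(x + x ^ 2) ^ k`. -/
def wordCount : ℕ → ℤ → ℚ
  | 0, m => if m = 0 then 1 else 0
  | k + 1, m => wordCount k (m - 1) + wordCount k (m - 2)

lemma wordCount_zero (m : ℤ) : wordCount 0 m = if m = 0 then 1 else 0 := rfl

lemma wordCount_succ (k : ℕ) (m : ℤ) :
    wordCount (k + 1) m = wordCount k (m - 1) + wordCount k (m - 2) := rfl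

lemma wordCount_eq_zero_of_lt {k : ℕ} {m : ℤ} (h : m < k) : wordCount k m = 0 := by
  induction k generalizing m with
  | zero => rw [wordCount_zero, if_neg (by simpa using h.ne)]
  | succ k ih =>
    push_cast at h
    rw [wordCount_succ, ih (by lia), ih (by lia), add_zero]

lemma sum_words_succ (k : ℕ) (F : ℕ → ℕ → ℚ) :
    ∑ w : Fin (k + 1) → ({1, 2} : Finset ℕ), F (∑ i : Fin k, (w i.castSucc : ℕ)) (w (Fin.last k)) =
      ∑ u : Fin k → ({1, 2} : Finset ℕ), (F (∑ i, (u i : ℕ)) 1 + F (∑ i, (u i : ℕ)) 2) := by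
  rw [← (Fin.snocEquiv fun _ => ({1, 2} : Finset ℕ)).sum_comp, Fintype.sum_prod_type_right]
  refine Finset.sum_congr rfl fun u _ => ?_
  simp only [Fin.snocEquiv, Equiv.coe_fn_mk, Fin.snoc_castSucc, Fin.snoc_last]
  rw [Finset.sum_coe_sort ({1, 2} : Finset ℕ) (fun x => F (∑ i, (u i : ℕ)) x)]
  simp

lemma sum_words_ite_eq_wordCount (k : ℕ) (m : ℤ) :
    ∑ w : Fin k → ({1, 2} : Finset ℕ), (if ((∑ i, (w i : ℕ) : ℕ) : ℤ) = m then (1 : ℚ) else 0) =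
      wordCount k m := by
  induction k generalizing m with
  | zero => simp [wordCount_zero, eq_comm]
  | succ k ih =>
    simp_rw [Fin.sum_univ_castSucc]
    rw [sum_words_succ k fun s x => if ((s + x : ℕ) : ℤ) = m then (1 : ℚ) else 0,
      Finset.sum_add_distrib, wordCount_succ, ← ih, ← ih]
    simp [eq_sub_iff_add_eq]

lemma partial_sums_lt_iff {n k : ℕ} (w : Fin (k + 1) → ℕ) :
    (∀ j : ℕ, j < k + 1 → ∑ i ∈ Finset.univ.filter (fun i : Fin (k + 1) => (i : ℕ) < j), w i < n) ↔
      ∑ i : Fin k, w i.castSucc < n := by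
  have h : ∑ i ∈ Finset.univ.filter (fun i : Fin (k + 1) => (i : ℕ) < k), w i =
      ∑ i : Fin k, w i.castSucc := by
    simp [Finset.sum_filter, Fin.sum_univ_castSucc]
  rw [← h]
  refine ⟨fun H => H k k.lt_succ_self, fun H j hj => lt_of_le_of_lt ?_ H⟩
  refine Finset.sum_le_sum_of_subset fun i => ?_
  simp only [Finset.mem_filter, Finset.mem_univ, true_and]
  lia

lemma N12_succ (n k : ℕ) :
    (N12 n (k + 1) : ℚ) = 2 * wordCount k (n - 1) + wordCount k (n - 2) := by
  rw [N12, Finset.card_filter]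
  push_cast
  simp_rw [partial_sums_lt_iff (fun i => ((_ : Fin (k + 1) → ({1, 2} : Finset ℕ)) i : ℕ)),
    Fin.sum_univ_castSucc]
  rw [sum_words_succ k fun s x => if n ≤ s + x ∧ s < n then (1 : ℚ) else 0,
    ← sum_words_ite_eq_wordCount, ← sum_words_ite_eq_wordCount, Finset.mul_sum,
    ← Finset.sum_add_distrib]
  refine Finset.sum_congr rfl fun u _ => ?_
  generalize ∑ i, (u i : ℕ) = s
  split_ifs <;> first | lia | norm_num

lemma wordCount_ratio (k : ℕ) (m : ℤ) :
    (m - k) * wordCount k m = (2 * k - m + 1) * wordCount k (m - 1) := by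
  induction k generalizing m with
  | zero =>
    obtain rfl | rfl | ⟨h₀, h₁⟩ : m = 0 ∨ m = 1 ∨ m ≠ 0 ∧ m ≠ 1 := by lia
    · simp [wordCount_zero]
    · simp [wordCount_zero]
    · simp [wordCount_zero, h₀, sub_eq_zero, h₁]
  | succ k ih =>
    have h₁ := ih (m - 1)
    have h₂ := ih (m - 2)
    rw [show m - 1 - 1 = m - 2 by ring] at h₁
    rw [show m - 2 - 1 = m - 3 by ring] at h₂
    rw [wordCount_succ, wordCount_succ, show m - 1 - 1 = m - 2 by ring,
      show m - 1 - 2 = m - 3 by ring]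
    push_cast at h₁ h₂ ⊢
    linear_combination h₁ + h₂

lemma wordCount_sq_recurrence (k : ℕ) (m : ℤ) :
    m * wordCount (k + 2) m ^ 2 - (2 * m - 1) * wordCount (k + 1) (m - 1) ^ 2
      - 2 * (m - 1) * wordCount (k + 1) (m - 2) ^ 2 + (m - 1) * wordCount k (m - 2) ^ 2
      - (2 * m - 3) * wordCount k (m - 3) ^ 2 + (m - 2) * wordCount k (m - 4) ^ 2 = 0 := by
  have h₁ := wordCount_ratio k (m - 2)
  have h₂ := wordCount_ratio k (m - 3)
  simp only [wordCount_succ, sub_sub] at h₁ h₂ ⊢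
  norm_num at h₁ h₂ ⊢
  generalize wordCount k (m - 2) = p at *
  generalize wordCount k (m - 3) = q at *
  generalize wordCount k (m - 4) = r at *
  linear_combination (2 * q + 4 * r) * h₁ - (2 * p + 4 * q) * h₂

/-- The partial sum over `k < M` of `wordCount k m ^ 2 / 4 ^ k`. -/
def sqSum (M : ℕ) (m : ℤ) : ℚ :=
  ∑ k ∈ Finset.range M, wordCount k m ^ 2 / 4 ^ k

lemma sqSum_succ (M : ℕ) (m : ℤ) : sqSum (M + 1) m = sqSum M m + wordCount M m ^ 2 / 4 ^ M :=
  Finset.sum_range_succ _ _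

lemma sqSum_recurrence_partial (M : ℕ) (m : ℤ) :
    16 * m * sqSum (M + 2) m = (8 * m - 4) * sqSum (M + 1) (m - 1)
      + 8 * (m - 1) * sqSum (M + 1) (m - 2) - (m - 1) * sqSum M (m - 2)
      + (2 * m - 3) * sqSum M (m - 3) - (m - 2) * sqSum M (m - 4) := by
  induction M with
  | zero =>
    obtain rfl | rfl | rfl | ⟨h₀, h₁, h₂⟩ :
        m = 0 ∨ m = 1 ∨ m = 2 ∨ m ≠ 0 ∧ m - 1 ≠ 0 ∧ m - 2 ≠ 0 := by lia
    · simp [sqSum, Finset.sum_range_succ, wordCount]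
    · simp [sqSum, Finset.sum_range_succ, wordCount]; norm_num
    · simp [sqSum, Finset.sum_range_succ, wordCount]; norm_num
    · simp [sqSum, Finset.sum_range_succ, wordCount, h₀, h₁, h₂]
  | succ M ih =>
    have h := wordCount_sq_recurrence M m
    rw [sqSum_succ M (m - 2)] at ih
    rw [show M + 1 + 2 = M + 2 + 1 from rfl, sqSum_succ (M + 2) m, sqSum_succ (M + 1) (m - 1),
      sqSum_succ (M + 1) (m - 2), sqSum_succ M (m - 2), sqSum_succ M (m - 3),
      sqSum_succ M (m - 4)]
    linear_combination ih + h / 4 ^ M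

/-- `∑ k, wordCount k m ^ 2 / 4 ^ k`, whose terms with `k > m` vanish. -/
def totalSqSum (m : ℤ) : ℚ :=
  sqSum (m.toNat + 1) m

lemma sqSum_eq_totalSqSum {M : ℕ} {m : ℤ} (h : m < M) : sqSum M m = totalSqSum m := by
  obtain hm | hm := lt_or_ge m 0
  · have hz : ∀ K, sqSum K m = 0 := fun K => Finset.sum_eq_zero fun k _ => by
      rw [wordCount_eq_zero_of_lt (by lia)]; simp
    rw [totalSqSum, hz, hz]
  · refine (Finset.sum_subset (Finset.range_mono (by lia)) fun k _ hk => ?_).symm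
    rw [wordCount_eq_zero_of_lt (by simp at hk; lia)]
    simp

lemma totalSqSum_recurrence (m : ℤ) :
    16 * m * totalSqSum m = (8 * m - 4) * totalSqSum (m - 1) + 7 * (m - 1) * totalSqSum (m - 2)
      + (2 * m - 3) * totalSqSum (m - 3) - (m - 2) * totalSqSum (m - 4) := by
  have h := sqSum_recurrence_partial (m.toNat + 1) m
  repeat rw [sqSum_eq_totalSqSum (by lia)] at h
  linear_combination h

lemma a12_eq_sum_range (n : ℕ) :
    a12 n = ∑ k ∈ Finset.range n,
      (2 * wordCount k (n - 1) + wordCount k (n - 2)) ^ 2 / 4 ^ (k + 1) := by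
  rw [a12, ← Finset.Ico_add_one_right_eq_Icc, Finset.sum_Ico_eq_sum_range, Nat.add_sub_cancel]
  refine Finset.sum_congr rfl fun k _ => ?_
  rw [add_comm 1 k, N12_succ, div_pow, ← pow_mul, mul_comm (k + 1) 2, pow_mul,
    show (2 : ℚ) ^ 2 = 4 by norm_num]

lemma a12_eq_totalSqSum {n : ℕ} (hn : n ≠ 0) :
    a12 n = 2 * totalSqSum n + totalSqSum (n - 1) / 2 - totalSqSum (n - 2) / 4 := by
  rw [← sqSum_eq_totalSqSum (M := n + 1) (m := n) (by lia),
    ← sqSum_eq_totalSqSum (M := n) (m := n - 1) (by lia),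
    ← sqSum_eq_totalSqSum (M := n) (m := n - 2) (by lia)]
  rw [sqSum, Finset.sum_range_succ', wordCount_zero, if_neg (by lia), sqSum, sqSum,
    a12_eq_sum_range, zero_pow two_ne_zero, zero_div, add_zero, Finset.mul_sum, Finset.sum_div,
    Finset.sum_div, ← Finset.sum_add_distrib, ← Finset.sum_sub_distrib]
  refine Finset.sum_congr rfl fun k _ => ?_
  rw [wordCount_succ, pow_succ]
  field_simp
  ring

/-- initial values and the fourth-order linear recurrence with polynomial
coefficients satisfied by `a(n) = Σ_{k=1}^n (N(n,k)/2^k)²` for `n ≥ 5`. -/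
theorem fair_coin_race_recurrence :
    a12 1 = 1 ∧ a12 2 = 1 / 2 ∧ a12 3 = 5 / 8 ∧ a12 4 = 15 / 32 ∧
    ∀ n : ℕ, 5 ≤ n →
      a12 n =
        (3 * (n : ℚ) - 1) * ((n : ℚ) - 3) / (2 * (n : ℚ) * (3 * (n : ℚ) - 7)) * a12 (n - 1) +
        (21 * (n : ℚ) ^ 2 - 67 * (n : ℚ) + 62) / (16 * (n : ℚ) * (3 * (n : ℚ) - 7)) * a12 (n - 2) +
        (6 * (n : ℚ) ^ 2 - 17 * (n : ℚ) + 2) / (16 * (n : ℚ) * (3 * (n : ℚ) - 7)) * a12 (n - 3) -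
        ((n : ℚ) - 4) * (3 * (n : ℚ) - 4) / (16 * (n : ℚ) * (3 * (n : ℚ) - 7)) * a12 (n - 4) := by
  refine ⟨?_, ?_, ?_, ?_, fun n hn => ?_⟩
  · norm_num [a12_eq_sum_range, Finset.sum_range_succ, wordCount]
  · norm_num [a12_eq_sum_range, Finset.sum_range_succ, wordCount]
  · norm_num [a12_eq_sum_range, Finset.sum_range_succ, wordCount]
  · norm_num [a12_eq_sum_range, Finset.sum_range_succ, wordCount]
  · have hn' : (5 : ℚ) ≤ n := by exact_mod_cast hn
    have h0 : (n : ℚ) ≠ 0 := by linarith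
    have h7 : 3 * (n : ℚ) - 7 ≠ 0 := by linarith
    have r₀ := totalSqSum_recurrence n
    have r₁ := totalSqSum_recurrence (n - 1)
    have r₂ := totalSqSum_recurrence (n - 2)
    rw [a12_eq_totalSqSum (by lia), a12_eq_totalSqSum (by lia), a12_eq_totalSqSum (by lia),
      a12_eq_totalSqSum (by lia), a12_eq_totalSqSum (by lia)]
    push_cast [Nat.cast_sub (show 1 ≤ n by lia), Nat.cast_sub (show 2 ≤ n by lia),
      Nat.cast_sub (show 3 ≤ n by lia), Nat.cast_sub (show 4 ≤ n by lia)] at r₀ r₁ r₂ ⊢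
    simp only [sub_sub] at r₀ r₁ r₂ ⊢
    norm_num at r₀ r₁ r₂ ⊢
    field_simp
    linear_combination 32 * (3 * (n : ℚ) - 7) * r₀ + 8 * (3 * (n : ℚ) - 1) * r₁
      - 4 * (3 * (n : ℚ) - 4) * r₂
end

section
/- For all integers k ≥ 1 and m ≥ 0, the number N of words of length (k+1)m + 1 with entries in {1, −k}, having exactly m entries equal to −k (equivalently, total sum equal to 1), and all proper prefix sums non-positive (the sum of the first j entries is ≤ 0 for all 1 ≤ j < (k+1)m+1), equals the Fuss–Catalan number ((k+1)m)! / ( m!·(km+1)! ); equivalently, ((k+1)m+1)·N = C((k+1)m+1, m). -/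
open Finset

/-- A sum over the indices of `Fin n` below `j` as a sum over `Finset.range j`. -/
theorem sum_fin_filter_lt_eq_sum_range {M : Type*} [AddCommMonoid M] {n : ℕ} (x : ℕ → M) {j : ℕ}
    (hj : j ≤ n) :
    ∑ i ∈ univ.filter (fun i : Fin n => (i : ℕ) < j), x i = ∑ i ∈ range j, x i := by
  rw [sum_filter, Fin.sum_univ_eq_sum_range (fun i => if i < j then x i else 0), ← sum_filter]
  congr 1
  ext i
  simp only [mem_filter, mem_range]
  omega

/-- The **cycle lemma** for a walk `S` whose increments are periodic with period `n` and which
gains `1` over each period: exactly one starting point in `[0, n)` is such that the walk stays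
weakly below its starting level for the next `n - 1` steps, namely the first maximum of `S`. -/
theorem existsUnique_forall_add_le {n : ℕ} (hn : 0 < n) (S : ℕ → ℤ)
    (hS : ∀ j, S (n + j) = S j + 1) :
    ∃! r : Fin n, ∀ j < n, S (r + j) ≤ S r := by
  have key (r : Fin n) : (∀ j < n, S (r + j) ≤ S r) ↔
      (∀ i : Fin n, S i ≤ S r) ∧ ∀ i : Fin n, i < r → S i < S r := by
    constructor
    · intro h
      have hlt (i : Fin n) (hi : i < r) : S i < S r := by
        have h1 := h (n + i - r) (by have := r.2; have := i.2; omega)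
        rw [show (r : ℕ) + (n + i - r) = n + i by have := r.2; omega, hS] at h1
        omega
      refine ⟨fun i => ?_, hlt⟩
      rcases lt_or_ge i r with hi | hi
      · exact (hlt i hi).le
      · have h1 := h (i - r) (by have := i.2; omega)
        rwa [Nat.add_sub_cancel' hi] at h1
    · rintro ⟨h1, h2⟩ j hj
      rcases lt_or_ge ((r : ℕ) + j) n with h | h
      · exact h1 ⟨r + j, h⟩
      · obtain ⟨c, hc⟩ := Nat.exists_eq_add_of_le h
        have hcr : c < r := by omega
        have h3 := h2 ⟨c, hcr.trans r.2⟩ hcr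
        rw [hc, hS]
        exact h3
  simp only [key]
  have : Nonempty (Fin n) := ⟨⟨0, hn⟩⟩
  obtain ⟨a, ha⟩ := Finite.exists_max (fun i : Fin n => S i)
  obtain ⟨r, hr, hmin⟩ := WellFounded.has_min (wellFounded_lt (α := Fin n))
    {r | ∀ i : Fin n, S i ≤ S r} ⟨a, ha⟩
  refine ⟨r, ⟨hr, fun i hi => ?_⟩, ?_⟩
  · by_contra! hle
    exact hmin i (fun b => (hr b).trans hle) hi
  · rintro s ⟨hs1, hs2⟩
    rcases lt_trichotomy s r with h | h | h
    · exact absurd h (hmin s hs1)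
    · exact h
    · exact absurd (hs2 r h) (hr s).not_gt

/-- Exactly one rotation of a finite integer sequence with sum `1` has only non-positive proper
prefix sums. -/
theorem existsUnique_rotation_prefix_sum_nonpos {n : ℕ} [NeZero n] (w : Fin n → ℤ)
    (hw : ∑ i, w i = 1) :
    ∃! r : Fin n, ∀ j < n, ∑ i ∈ univ.filter (fun i : Fin n => (i : ℕ) < j), w (i + r) ≤ 0 := by
  set x : ℕ → ℤ := fun i => w (Fin.ofNat n i) with hx
  have hn : ∑ i ∈ range n, x i = 1 := by
    rw [← hw, ← Fin.sum_univ_eq_sum_range]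
    simp [hx]
  have hS (j : ℕ) : ∑ i ∈ range (n + j), x i = ∑ i ∈ range j, x i + 1 := by
    rw [sum_range_add, hn, add_comm]
    simp [hx, Fin.ofNat]
  refine (existsUnique_congr fun r => ?_).mp
    (existsUnique_forall_add_le (NeZero.pos n) (fun j => ∑ i ∈ range j, x i) hS)
  refine forall₂_congr fun j hj => ?_
  have h : ∑ i ∈ univ.filter (fun i : Fin n => (i : ℕ) < j), w (i + r) =
      ∑ i ∈ range j, x (r + i) := by
    rw [← sum_fin_filter_lt_eq_sum_range (fun i => x (r + i)) hj.le]
    refine sum_congr rfl fun i _ => congrArg w (Fin.ext ?_)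
    simp [Fin.val_add, add_comm]
  rw [h]
  simp only [sum_range_add]
  omega

/-- Over a finite alphabet of integers, the words of length `n` with sum `1` are `n` times as many
as those among them whose proper prefix sums are non-positive. -/
theorem mul_card_prefix_sum_nonpos_eq_card_sum_eq_one {n : ℕ} [NeZero n] (A : Finset ℤ) :
    n * (univ.filter (fun w : Fin n → A => (∑ i, (w i : ℤ)) = 1 ∧
      ∀ j : ℕ, j < n →
        (∑ i ∈ univ.filter (fun i : Fin n => (i : ℕ) < j), (w i : ℤ)) ≤ 0)).card =
    (univ.filter (fun w : Fin n → A => (∑ i, (w i : ℤ)) = 1)).card := by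
  classical
  set G := univ.filter (fun w : Fin n → A => (∑ i, (w i : ℤ)) = 1 ∧
      ∀ j : ℕ, j < n →
        (∑ i ∈ univ.filter (fun i : Fin n => (i : ℕ) < j), (w i : ℤ)) ≤ 0) with hG
  have hsum (w : Fin n → A) (r : Fin n) : ∑ i, (w (i + r) : ℤ) = ∑ i, (w i : ℤ) :=
    Equiv.sum_comp (Equiv.addRight r) (fun i => (w i : ℤ))
  have hcard : n * G.card = ((univ : Finset (Fin n)) ×ˢ G).card := by simp
  rw [hcard]
  refine card_bij (fun p _ i => p.2 (i - p.1)) ?_ ?_ ?_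
  · rintro ⟨r, w⟩ hp
    simp only [hG, mem_product, mem_filter, mem_univ, true_and] at hp ⊢
    rw [← hp.1, ← hsum _ r]
    simp
  · rintro ⟨r, w⟩ hp ⟨s, v⟩ hq h
    simp only [hG, mem_product, mem_filter, mem_univ, true_and] at hp hq
    have hwv (i : Fin n) : w (i - r) = v (i - s) := congrFun h i
    have hu : ∑ i, (w (i - r) : ℤ) = 1 := by
      rw [← hp.1, ← hsum _ r]
      simp
    have hrs : r = s := by
      refine (existsUnique_rotation_prefix_sum_nonpos (fun i => (w (i - r) : ℤ)) hu).unique ?_ ?_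
      · simpa using hp.2
      · simpa [hwv] using hq.2
    subst hrs
    refine Prod.ext rfl (funext fun i => ?_)
    simpa using hwv (i + r)
  · intro w hw
    simp only [mem_filter, mem_univ, true_and] at hw
    obtain ⟨r, hr, -⟩ := existsUnique_rotation_prefix_sum_nonpos (fun i => (w i : ℤ)) hw
    refine ⟨(r, fun i => w (i + r)), ?_, by simp⟩
    simp only [hG, mem_product, mem_filter, mem_univ, true_and]
    exact ⟨(hsum w r).trans hw, hr⟩

/-- A word over `{1, -k}` of length `(k + 1) * m + 1` has sum `1` iff exactly `m` of its entries
are `-k`. -/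
theorem sum_eq_one_iff_card_eq (k m : ℕ)
    (w : Fin ((k + 1) * m + 1) → ({1, -(k : ℤ)} : Finset ℤ)) :
    (∑ i, (w i : ℤ)) = 1 ↔ (univ.filter fun i => (w i : ℤ) = -(k : ℤ)).card = m := by
  have h (i) : (w i : ℤ) = 1 - (k + 1) * if (w i : ℤ) = -(k : ℤ) then 1 else 0 := by
    have := (w i).2
    simp only [mem_insert, mem_singleton] at this
    split_ifs with h <;> grind
  have hs : (∑ i, (w i : ℤ)) = ((k + 1) * m + 1 : ℕ) -
      (k + 1) * (univ.filter fun i => (w i : ℤ) = -(k : ℤ)).card := by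
    rw [sum_congr rfl fun i _ => h i, sum_sub_distrib, ← mul_sum, sum_boole]
    simp
  rw [hs]
  have hk : (k + 1 : ℤ) ≠ 0 := by positivity
  push_cast
  constructor
  · intro h1
    have h2 := mul_left_cancel₀ hk (show (k + 1 : ℤ) *
      (univ.filter fun i => (w i : ℤ) = -(k : ℤ)).card = (k + 1) * m by linarith)
    exact_mod_cast h2
  · intro h1
    rw [h1]
    ring

/-- The number of words over `{1, -k}` of length `(k + 1) * m + 1` with sum `1`. -/
theorem card_sum_eq_one (k m : ℕ) :
    (univ.filter (fun w : Fin ((k + 1) * m + 1) → ({1, -(k : ℤ)} : Finset ℤ) =>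
      (∑ i, (w i : ℤ)) = 1)).card = Nat.choose ((k + 1) * m + 1) m := by
  classical
  have hk : (1 : ℤ) ≠ -(k : ℤ) := by omega
  trans (powersetCard m (univ : Finset (Fin ((k + 1) * m + 1)))).card
  · refine card_nbij' (fun w => univ.filter fun i => (w i : ℤ) = -(k : ℤ))
      (fun s i => if i ∈ s then ⟨-(k : ℤ), by simp⟩ else ⟨1, by simp⟩) ?_ ?_ ?_ ?_
    · intro w hw
      simpa [mem_powersetCard, sum_eq_one_iff_card_eq] using hw
    · intro s hs
      have : (univ.filter fun i => i ∉ s → (1 : ℤ) = -(k : ℤ)) = s := by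
        ext i
        simp [hk]
      simp only [coe_filter, mem_univ, true_and, Set.mem_ofPred_eq, sum_eq_one_iff_card_eq]
      simpa [apply_ite Subtype.val, ite_eq_left_iff, this] using hs
    · intro w _
      funext i
      have := (w i).2
      simp only [mem_insert, mem_singleton] at this
      apply Subtype.ext
      by_cases h : (w i : ℤ) = -(k : ℤ)
      · simp [h]
      · simp [hk, this.resolve_right h]
    · intro s _
      ext i
      by_cases h : i ∈ s <;> simp [h, hk]
  · simp


/-- `fussCount k m` : the number of words of length `(k+1)m + 1` with entries in
`{1, −k}`, total sum `1` (equivalently, exactly `m` entries equal to `−k`), and all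
proper prefix sums non-positive. -/
def fussCount (k m : ℕ) : ℕ :=
  (Finset.univ.filter (fun w : Fin ((k + 1) * m + 1) → ({1, -(k : ℤ)} : Finset ℤ) =>
      (∑ i : Fin ((k + 1) * m + 1), (w i : ℤ)) = 1 ∧
      ∀ j : ℕ, j < (k + 1) * m + 1 →
        (∑ i ∈ Finset.univ.filter (fun i : Fin ((k + 1) * m + 1) => (i : ℕ) < j),
          (w i : ℤ)) ≤ 0)).card

/-- For k ≥ 1 and m ≥ 0, the number N of words over `{1, −k}` of length
`(k+1)m+1` with sum 1 and non-positive proper prefix sums equals the Fuss–Catalan number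
`((k+1)m)!/(m!·(km+1)!)`; equivalently `((k+1)m+1)·N = C((k+1)m+1, m)`. -/
theorem fuss_catalan_count (k m : ℕ) (hk : 1 ≤ k) :
    fussCount k m * (Nat.factorial m * Nat.factorial (k * m + 1)) =
      Nat.factorial ((k + 1) * m) ∧
    ((k + 1) * m + 1) * fussCount k m = Nat.choose ((k + 1) * m + 1) m := by
  have hcount : ((k + 1) * m + 1) * fussCount k m = Nat.choose ((k + 1) * m + 1) m :=
    (mul_card_prefix_sum_nonpos_eq_card_sum_eq_one _).trans (card_sum_eq_one k m)
  refine ⟨Nat.eq_of_mul_eq_mul_left (Nat.succ_pos ((k + 1) * m)) ?_, hcount⟩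
  have hsub : (k + 1) * m + 1 - m = k * m + 1 := by
    rw [add_mul, one_mul]
    omega
  have hle : m ≤ (k + 1) * m + 1 := by
    rw [add_mul, one_mul]
    omega
  have h := Nat.choose_mul_factorial_mul_factorial hle
  rw [hsub, ← hcount, Nat.factorial_succ ((k + 1) * m)] at h
  rw [Nat.succ_eq_add_one, ← h]
  ring
end

section
/- Let p be a real number with 1/2 < p ≤ 1 and let m ≥ 1 be an integer. Then the series Σ_{n=0}^∞ (2n+m) · ( m·(2n+m−1)!/(n!·(n+m)!) ) · p^{n+m} (1−p)^n converges and its sum equals m/(2p−1). (That is, in the gambling game where at each round one wins a dollar with probability p and loses a dollar with probability 1−p, starting from 0, the expected number of rounds until the capital first reaches m is m/(2p−1).) -/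
/-- The probability that the ±1 walk is at height `m` after `2 * n + m` rounds. -/
noncomputable def walkVisitProb (p : ℝ) (m n : ℕ) : ℝ :=
  ((2 * n + m).choose n : ℝ) * p ^ (n + m) * (1 - p) ^ n

lemma walkVisitProb_nonneg {p : ℝ} (hp : 0 ≤ p) (hp1 : p ≤ 1) (m n : ℕ) :
    0 ≤ walkVisitProb p m n := by
  have : 0 ≤ 1 - p := sub_nonneg.2 hp1
  unfold walkVisitProb
  positivity

lemma walkVisitProb_le {p : ℝ} (hp : 0 ≤ p) (hp1 : p ≤ 1) (m n : ℕ) :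
    walkVisitProb p m n ≤ (2 * p) ^ m * (4 * p * (1 - p)) ^ n := by
  have hq : 0 ≤ 1 - p := sub_nonneg.2 hp1
  have hc : ((2 * n + m).choose n : ℝ) ≤ 2 ^ (2 * n + m) := by
    exact_mod_cast Nat.choose_le_two_pow _ _
  calc walkVisitProb p m n ≤ 2 ^ (2 * n + m) * p ^ (n + m) * (1 - p) ^ n := by
        unfold walkVisitProb
        gcongr
    _ = (2 * p) ^ m * (4 * p * (1 - p)) ^ n := by
        rw [show (4 : ℝ) = 2 ^ 2 by norm_num]
        simp only [mul_pow, pow_add, pow_mul]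
        ring

lemma summable_geometric_bound {p : ℝ} (hp : 1 / 2 < p) (hp1 : p ≤ 1) (m : ℕ) :
    Summable fun n : ℕ => (2 * p) ^ m * (4 * p * (1 - p)) ^ n :=
  (summable_geometric_of_lt_one (by nlinarith) (by nlinarith)).mul_left _

lemma summable_walkVisitProb {p : ℝ} (hp : 1 / 2 < p) (hp1 : p ≤ 1) (m : ℕ) :
    Summable (walkVisitProb p m) :=
  (summable_geometric_bound hp hp1 m).of_nonneg_of_le
    (walkVisitProb_nonneg (by linarith) hp1 m) (walkVisitProb_le (by linarith) hp1 m)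

lemma tsum_walkVisitProb_le {p : ℝ} (hp : 1 / 2 < p) (hp1 : p ≤ 1) (m : ℕ) :
    ∑' n, walkVisitProb p m n ≤ (2 * p) ^ m * (1 - 4 * p * (1 - p))⁻¹ := by
  rw [← tsum_geometric_of_lt_one (r := 4 * p * (1 - p)) (by nlinarith) (by nlinarith),
    ← tsum_mul_left]
  exact (summable_walkVisitProb hp hp1 m).tsum_le_tsum (walkVisitProb_le (by linarith) hp1 m)
    (summable_geometric_bound hp hp1 m)

lemma tsum_walkVisitProb_succ {p : ℝ} (hp : 1 / 2 < p) (hp1 : p ≤ 1) (m : ℕ) :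
    ∑' n, walkVisitProb p (m + 1) n =
      p * ∑' n, walkVisitProb p m n + (1 - p) * ∑' n, walkVisitProb p (m + 2) n := by
  have hs := summable_walkVisitProb hp hp1
  have hstep (n : ℕ) : walkVisitProb p (m + 1) (n + 1) =
      p * walkVisitProb p m (n + 1) + (1 - p) * walkVisitProb p (m + 2) n := by
    unfold walkVisitProb
    rw [show 2 * (n + 1) + (m + 1) = (2 * n + (m + 2)) + 1 by ring,
      show 2 * (n + 1) + m = 2 * n + (m + 2) by ring, Nat.choose_succ_succ]
    push_cast
    ring
  have hzero : walkVisitProb p (m + 1) 0 = p * walkVisitProb p m 0 := by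
    simp [walkVisitProb, pow_succ']
  rw [(hs (m + 1)).tsum_eq_zero_add, (hs m).tsum_eq_zero_add, hzero]
  simp_rw [hstep]
  rw [(((summable_nat_add_iff 1).2 (hs m)).mul_left p).tsum_add ((hs (m + 2)).mul_left (1 - p)),
    tsum_mul_left, tsum_mul_left]
  ring

lemma tsum_walkVisitProb_zero {p : ℝ} (hp : 1 / 2 < p) (hp1 : p ≤ 1) :
    ∑' n, walkVisitProb p 0 n = 1 + 2 * (1 - p) * ∑' n, walkVisitProb p 1 n := by
  have hstep (n : ℕ) : walkVisitProb p 0 (n + 1) = 2 * (1 - p) * walkVisitProb p 1 n := by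
    unfold walkVisitProb
    rw [show 2 * (n + 1) + 0 = (2 * n + 1) + 1 by ring, Nat.choose_succ_succ,
      ← Nat.choose_symm_half n]
    push_cast
    ring
  rw [(summable_walkVisitProb hp hp1 0).tsum_eq_zero_add]
  simp_rw [hstep]
  rw [tsum_mul_left]
  simp [walkVisitProb]

lemma tsum_walkVisitProb_succ_eq {p : ℝ} (hp : 1 / 2 < p) (hp1 : p ≤ 1) (m : ℕ) :
    ∑' n, walkVisitProb p (m + 1) n = ∑' n, walkVisitProb p m n := by
  set S : ℕ → ℝ := fun k => ∑' n, walkVisitProb p k n with hS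
  set B : ℝ := (1 - 4 * p * (1 - p))⁻¹ with hB
  have hp0 : 0 < p := by linarith
  have hq : 0 ≤ 1 - p := sub_nonneg.2 hp1
  have hB0 : 0 ≤ B := inv_nonneg.2 (by nlinarith)
  have hS0 (k : ℕ) : 0 ≤ S k := tsum_nonneg (walkVisitProb_nonneg hp0.le hp1 k)
  have hSB (k : ℕ) : S k ≤ (2 * p) ^ k * B := tsum_walkVisitProb_le hp hp1 k
  have hrec (j : ℕ) :
      p ^ j * (S (m + 1) - S m) = (1 - p) ^ j * (S (m + j + 1) - S (m + j)) := by
    induction j with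
    | zero => simp
    | succ j ih =>
      have h : S (m + j + 1) = p * S (m + j) + (1 - p) * S (m + j + 2) :=
        tsum_walkVisitProb_succ hp hp1 (m + j)
      rw [pow_succ', mul_assoc, ih, ← add_assoc, pow_succ]
      linear_combination (1 - p) ^ j * h
  have hdiff (k : ℕ) : |S (k + 1) - S k| ≤ (2 * p) ^ (k + 1) * B := by
    have hmono : (2 * p) ^ k * B ≤ (2 * p) ^ (k + 1) * B := by
      gcongr
      · linarith
      · omega
    rw [abs_le]
    constructor <;> linarith [hS0 k, hS0 (k + 1), hSB k, hSB (k + 1)]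
  have hbound (j : ℕ) :
      |S (m + 1) - S m| ≤ (2 * (1 - p)) ^ j * ((2 * p) ^ (m + 1) * B) := by
    refine le_of_mul_le_mul_left ?_ (pow_pos hp0 j)
    calc p ^ j * |S (m + 1) - S m| = (1 - p) ^ j * |S (m + j + 1) - S (m + j)| := by
          simpa [abs_mul, abs_of_pos hp0, abs_of_nonneg hq] using congrArg abs (hrec j)
      _ ≤ (1 - p) ^ j * ((2 * p) ^ (m + j + 1) * B) := by
          gcongr
          exact hdiff _
      _ = p ^ j * ((2 * (1 - p)) ^ j * ((2 * p) ^ (m + 1) * B)) := by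
          simp only [mul_pow, pow_add]
          ring
  have hlim : Filter.Tendsto (fun j : ℕ => (2 * (1 - p)) ^ j * ((2 * p) ^ (m + 1) * B))
      Filter.atTop (nhds 0) := by
    simpa using (tendsto_pow_atTop_nhds_zero_of_lt_one (r := 2 * (1 - p))
      (by linarith) (by linarith)).mul_const ((2 * p) ^ (m + 1) * B)
  exact sub_eq_zero.1 (abs_nonpos_iff.1 (ge_of_tendsto' hlim hbound))

lemma hasSum_walkVisitProb {p : ℝ} (hp : 1 / 2 < p) (hp1 : p ≤ 1) (m : ℕ) :
    HasSum (walkVisitProb p m) (1 / (2 * p - 1)) := by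
  suffices h : ∑' n, walkVisitProb p m n = 1 / (2 * p - 1) from
    h ▸ (summable_walkVisitProb hp hp1 m).hasSum
  induction m with
  | zero =>
    have h := tsum_walkVisitProb_zero hp hp1
    rw [tsum_walkVisitProb_succ_eq hp hp1 0] at h
    rw [eq_div_iff (by linarith)]
    linear_combination h
  | succ m ih => rw [tsum_walkVisitProb_succ_eq hp hp1 m, ih]


/-- For 1/2 < p ≤ 1 and m ≥ 1, the expected duration of the ±1 gambling
walk (win a dollar with probability p, lose one with probability 1−p) until first
reaching capital m equals m/(2p−1):
`Σ_{n≥0} (2n+m)·(m·(2n+m−1)!/(n!·(n+m)!))·p^{n+m}(1−p)^n = m/(2p−1)`. -/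
theorem expected_duration_pm_one_walk (p : ℝ) (hp : 1 / 2 < p) (hp1 : p ≤ 1)
    (m : ℕ) (hm : 1 ≤ m) :
    HasSum
      (fun n : ℕ =>
        ((2 * n + m : ℕ) : ℝ) *
          ((m : ℝ) * ((2 * n + m - 1).factorial : ℝ) /
            ((n.factorial : ℝ) * ((n + m).factorial : ℝ))) *
          p ^ (n + m) * (1 - p) ^ n)
      ((m : ℝ) / (2 * p - 1)) := by
  have h := (hasSum_walkVisitProb hp hp1 m).mul_left (m : ℝ)
  rw [mul_one_div] at h
  refine (congrArg (HasSum · _) (funext fun n => ?_)).mpr h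
  have hfact : ((2 * n + m : ℕ) : ℝ) * ((2 * n + m - 1).factorial : ℝ) =
      ((2 * n + m).factorial : ℝ) := by
    exact_mod_cast Nat.mul_factorial_pred (by omega)
  rw [walkVisitProb, Nat.cast_choose ℝ (show n ≤ 2 * n + m by omega),
    show 2 * n + m - n = n + m by omega, ← hfact]
  ring
end

section
/- For m ≥ 1 define f(m) = Σ_{n=0}^∞ ( m·(2n+m−1)! / ( n!·(n+m)!·2^{2n+m} ) )², a convergent series of real numbers. Then f(1) = (4−π)/π, f(2) = (16−5π)/π, and for every m ≥ 1: (2m²+5m+2)·f(m+2) − (12m²+24m+10)·f(m+1) + (2m²+3m)·f(m) = −8/π. -/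
/-- `b16 m n` : the probability `b_{n,m} = m·(2n+m−1)!/(n!·(n+m)!·2^{2n+m})` that a fair
±1 gambling walk starting at 0 first reaches capital m after exactly 2n+m rounds. -/
noncomputable def b16 (m n : ℕ) : ℝ :=
  (m : ℝ) * ((2 * n + m - 1).factorial : ℝ) /
    ((n.factorial : ℝ) * ((n + m).factorial : ℝ) * 2 ^ (2 * n + m))

/-- `f16 m = Σ_{n≥0} b_{n,m}²`. -/
noncomputable def f16 (m : ℕ) : ℝ := ∑' n : ℕ, (b16 m n) ^ 2

open Filter Topology

theorem b16_succ_left (m n : ℕ) :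
    b16 (m + 2) n =
      ((m : ℝ) + 2) * (2 * n + m + 1) / (2 * (m + 1) * (n + m + 2)) * b16 (m + 1) n := by
  unfold b16
  rw [show 2 * n + (m + 2) - 1 = 2 * n + m + 1 by omega,
    show 2 * n + (m + 1) - 1 = 2 * n + m by omega,
    show n + (m + 2) = n + (m + 1) + 1 by omega,
    show 2 * n + (m + 2) = 2 * n + (m + 1) + 1 by omega,
    Nat.factorial_succ (2 * n + m), Nat.factorial_succ (n + (m + 1)), pow_succ]
  push_cast
  field_simp
  ring

theorem b16_succ_right (m n : ℕ) :
    b16 (m + 1) (n + 1) =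
      (2 * (n : ℝ) + m + 2) * (2 * n + m + 1) / (4 * (n + 1) * (n + m + 2)) *
        b16 (m + 1) n := by
  unfold b16
  rw [show 2 * (n + 1) + (m + 1) - 1 = 2 * n + m + 1 + 1 by omega,
    show 2 * n + (m + 1) - 1 = 2 * n + m by omega,
    show n + 1 + (m + 1) = n + (m + 1) + 1 by omega,
    show 2 * (n + 1) + (m + 1) = 2 * n + (m + 1) + 1 + 1 by omega,
    Nat.factorial_succ (2 * n + m + 1), Nat.factorial_succ (2 * n + m),
    Nat.factorial_succ (n + (m + 1)), Nat.factorial_succ n, pow_succ, pow_succ]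
  push_cast
  field_simp
  ring

theorem b16_one_sq (n : ℕ) :
    b16 1 n ^ 2 = 1 / (4 * ((n : ℝ) + 1) ^ 2 * (2 * n + 1) * Real.Wallis.W n) := by
  rw [Real.Wallis.W_eq_factorial_ratio]
  unfold b16
  rw [show 2 * n + 1 - 1 = 2 * n by omega, Nat.factorial_succ n, pow_succ 2 (2 * n),
    mul_comm 4 n, pow_mul 2 n 4, pow_mul' 2 2 n]
  push_cast
  field_simp
  norm_num

/-- Along the positive integers, `a n` may be computed as `g (1 / n)`. -/
theorem tendsto_of_eq_comp_one_div {a : ℕ → ℝ} {g : ℝ → ℝ} (hg : ContinuousAt g 0)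
    (h : ∀ n : ℕ, 0 < n → a n = g (1 / (n : ℝ))) : Tendsto a atTop (𝓝 (g 0)) := by
  refine (hg.tendsto.comp tendsto_one_div_atTop_nhds_zero_nat).congr' ?_
  filter_upwards [eventually_gt_atTop 0] with n hn
  exact (h n hn).symm

theorem tendsto_cube_mul_b16_sq (m : ℕ) :
    Tendsto (fun n : ℕ => (n : ℝ) ^ 3 * b16 (m + 1) n ^ 2) atTop
      (𝓝 (((m : ℝ) + 1) ^ 2 / (4 * Real.pi))) := by
  induction m with
  | zero =>
    have h := by
      refine tendsto_of_eq_comp_one_div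
        (a := fun n : ℕ => (n : ℝ) ^ 3 / (4 * (n + 1) ^ 2 * (2 * n + 1)))
        (g := fun x : ℝ => 1 / (4 * (1 + x) ^ 2 * (2 + x))) ?_ fun n hn => ?_
      · exact ContinuousAt.div (by fun_prop) (by fun_prop) (by norm_num)
      · have : (n : ℝ) ≠ 0 := by positivity
        field_simp
    have h2 := h.div Real.Wallis.tendsto_W_nhds_pi_div_two (by positivity)
    convert h2 using 2
    · rw [zero_add, b16_one_sq, Pi.div_apply, div_div, mul_one_div]
    · have := Real.pi_pos
      field_simp
      norm_num
  | succ m ih =>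
    have h := by
      refine tendsto_of_eq_comp_one_div
        (a := fun n : ℕ => (((m : ℝ) + 2) * (2 * n + m + 1) /
        (2 * (m + 1) * (n + m + 2))) ^ 2)
        (g := fun x : ℝ => (((m : ℝ) + 2) * (2 + (m + 1) * x) /
          (2 * (m + 1) * (1 + (m + 2) * x))) ^ 2) ?_ fun n hn => ?_
      · refine ContinuousAt.pow (ContinuousAt.div (by fun_prop) (by fun_prop) ?_) 2
        have : (m : ℝ) + 1 ≠ 0 := by positivity
        simpa using this
      · have : (n : ℝ) ≠ 0 := by positivity
        field_simp
        ring
    convert h.mul ih using 2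
    · rw [b16_succ_left]; ring
    · have := Real.pi_pos
      push_cast
      field_simp
      ring

theorem sum_range_of_eq_sub {u G : ℕ → ℝ} (hu : ∀ n, u n = G (n + 1) - G n) (N : ℕ) :
    ∑ n ∈ Finset.range N, u n = G N - G 0 := by
  simp_rw [hu]
  exact Finset.sum_range_sub G N

theorem hasSum_b16_one_sq :
    HasSum (fun n => b16 1 n ^ 2) ((4 - Real.pi) / Real.pi) := by
  rw [hasSum_iff_tendsto_nat_of_nonneg fun n => sq_nonneg _]
  simp_rw [sum_range_of_eq_sub (u := fun n => b16 1 n ^ 2)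
    (G := fun n : ℕ => (16 * (n : ℝ) ^ 3 + 36 * n ^ 2 + 24 * n + 4) * b16 1 n ^ 2) (fun n => by
      rw [b16_succ_right 0 n]
      push_cast
      field_simp
      ring)]
  have h := by
    refine tendsto_of_eq_comp_one_div
      (a := fun n : ℕ => (16 * (n : ℝ) ^ 3 + 36 * n ^ 2 + 24 * n + 4) / n ^ 3)
      (g := fun x : ℝ => 16 + 36 * x + 24 * x ^ 2 + 4 * x ^ 3) (by fun_prop) fun n hn => ?_
    have : (n : ℝ) ≠ 0 := by positivity
    field_simp
  have h2 := (h.mul (tendsto_cube_mul_b16_sq 0)).sub_const 1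
  have h0 : b16 1 0 = 1 / 2 := by norm_num [b16]
  convert h2.congr' ?_ using 2
  · have := Real.pi_pos
    field_simp
    norm_num
    ring
  · filter_upwards [eventually_gt_atTop 0] with n hn
    have : (n : ℝ) ≠ 0 := by positivity
    rw [h0]
    field_simp
    norm_num
    ring

theorem summable_b16_sq (m : ℕ) : Summable fun n => b16 (m + 1) n ^ 2 := by
  induction m with
  | zero => exact hasSum_b16_one_sq.summable
  | succ m ih =>
    refine Summable.of_nonneg_of_le (fun n => sq_nonneg _) (fun n => ?_)
      (ih.mul_left (((m : ℝ) + 2) ^ 2))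
    rw [b16_succ_left, mul_pow]
    gcongr
    rw [div_le_iff₀ (by positivity)]
    gcongr
    nlinarith [(n.cast_nonneg : (0 : ℝ) ≤ n), (m.cast_nonneg : (0 : ℝ) ≤ m),
      mul_nonneg (n.cast_nonneg : (0 : ℝ) ≤ n) (m.cast_nonneg : (0 : ℝ) ≤ m)]

theorem tsum_of_eq_sub {u G : ℕ → ℝ} {L : ℝ} (hs : Summable u)
    (hu : ∀ n, u n = G (n + 1) - G n) (hG : Tendsto G atTop (𝓝 L)) :
    ∑' n, u n = L - G 0 := by
  refine tendsto_nhds_unique hs.hasSum.tendsto_sum_nat ?_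
  simp_rw [sum_range_of_eq_sub hu]
  exact hG.sub_const _

theorem f16_two : f16 2 = (16 - 5 * Real.pi) / Real.pi := by
  have h := by
    refine tendsto_of_eq_comp_one_div
      (a := fun n : ℕ => (64 * (n : ℝ) ^ 3 + 144 * n ^ 2 + 96 * n + 20) / n ^ 3)
      (g := fun x : ℝ => 64 + 144 * x + 96 * x ^ 2 + 20 * x ^ 3) (by fun_prop) fun n hn => ?_
    have : (n : ℝ) ≠ 0 := by positivity
    field_simp
  have h0 : b16 1 0 = 1 / 2 := by norm_num [b16]
  unfold f16
  rw [tsum_of_eq_sub (summable_b16_sq 1)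
    (G := fun n : ℕ => (64 * (n : ℝ) ^ 3 + 144 * n ^ 2 + 96 * n + 20) * b16 1 n ^ 2)
    (fun n => ?_) ((h.mul (tendsto_cube_mul_b16_sq 0)).congr' ?_)]
  · have := Real.pi_pos
    rw [h0]
    field_simp
    norm_num
    ring
  · filter_upwards [eventually_gt_atTop 0] with n hn
    have : (n : ℝ) ≠ 0 := by positivity
    rw [zero_add]
    field_simp
  · rw [b16_succ_left 0 n, b16_succ_right 0 n]
    push_cast
    field_simp
    ring

/-- The numerator of the telescoping certificate for the recurrence of `f16`. -/
noncomputable def certPoly (m x : ℝ) : ℝ :=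
  -(128 * x ^ 3 + (64 * m ^ 2 + 448 * m + 288) * x ^ 2 +
    (128 * m ^ 3 + 640 * m ^ 2 + 704 * m + 192) * x +
    (56 * m ^ 4 + 268 * m ^ 3 + 360 * m ^ 2 + 144 * m))

/-- The telescoping certificate for the recurrence of `f16`. -/
noncomputable def cert (m n : ℕ) : ℝ :=
  (n : ℝ) ^ 2 * certPoly m n / ((m + 1) ^ 2 * (2 * n + m) ^ 2) * b16 (m + 1) n ^ 2

theorem tendsto_cert (m : ℕ) : Tendsto (cert m) atTop (𝓝 (-8 / Real.pi)) := by
  have h := by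
    refine tendsto_of_eq_comp_one_div
      (a := fun n : ℕ => certPoly m n / (n * ((m + 1) ^ 2 * (2 * (n : ℝ) + m) ^ 2)))
      (g := fun x : ℝ => -(128 + (64 * (m : ℝ) ^ 2 + 448 * m + 288) * x +
        (128 * (m : ℝ) ^ 3 + 640 * m ^ 2 + 704 * m + 192) * x ^ 2 +
        (56 * (m : ℝ) ^ 4 + 268 * m ^ 3 + 360 * m ^ 2 + 144 * m) * x ^ 3) /
        ((m + 1) ^ 2 * (2 + m * x) ^ 2)) ?_ fun n hn => ?_
    · refine ContinuousAt.div (by fun_prop) (by fun_prop) ?_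
      have : (m : ℝ) + 1 ≠ 0 := by positivity
      simpa using this
    · have : (n : ℝ) ≠ 0 := by positivity
      unfold certPoly
      field_simp
  convert (h.mul (tendsto_cube_mul_b16_sq m)).congr' ?_ using 2
  · have := Real.pi_pos
    field_simp
    norm_num
  · filter_upwards [eventually_gt_atTop 0] with n hn
    have : (n : ℝ) ≠ 0 := by positivity
    unfold cert
    field_simp

theorem b16_recurrence (m n : ℕ) :
    (2 * ((m + 1 : ℕ) : ℝ) ^ 2 + 5 * (m + 1 : ℕ) + 2) * b16 (m + 3) n ^ 2 -
      (12 * ((m + 1 : ℕ) : ℝ) ^ 2 + 24 * (m + 1 : ℕ) + 10) * b16 (m + 2) n ^ 2 +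
      (2 * ((m + 1 : ℕ) : ℝ) ^ 2 + 3 * (m + 1 : ℕ)) * b16 (m + 1) n ^ 2 =
    cert (m + 1) (n + 1) - cert (m + 1) n := by
  unfold cert certPoly
  rw [b16_succ_right (m + 1) n, b16_succ_left (m + 1) n, b16_succ_left m n]
  push_cast
  field_simp
  ring

/-- The series `f(m) = Σ_n (m·(2n+m−1)!/(n!·(n+m)!·2^{2n+m}))²` converges,
`f(1) = (4−π)/π`, `f(2) = (16−5π)/π`, and for all m ≥ 1,
`(2m²+5m+2)·f(m+2) − (12m²+24m+10)·f(m+1) + (2m²+3m)·f(m) = −8/π`. -/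
theorem fair_coin_two_player_recurrence :
    (∀ m : ℕ, 1 ≤ m → Summable (fun n : ℕ => (b16 m n) ^ 2)) ∧
    f16 1 = (4 - Real.pi) / Real.pi ∧
    f16 2 = (16 - 5 * Real.pi) / Real.pi ∧
    ∀ m : ℕ, 1 ≤ m →
      (2 * (m : ℝ) ^ 2 + 5 * m + 2) * f16 (m + 2) -
        (12 * (m : ℝ) ^ 2 + 24 * m + 10) * f16 (m + 1) +
        (2 * (m : ℝ) ^ 2 + 3 * m) * f16 m = -8 / Real.pi := by
  refine ⟨fun m hm => ?_, hasSum_b16_one_sq.tsum_eq, f16_two, fun m hm => ?_⟩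
  · obtain ⟨k, rfl⟩ := Nat.exists_eq_add_of_le' hm
    exact summable_b16_sq k
  · obtain ⟨k, rfl⟩ := Nat.exists_eq_add_of_le' hm
    have s0 := summable_b16_sq k
    have s1 := summable_b16_sq (k + 1)
    have s2 := summable_b16_sq (k + 2)
    have hs := ((s2.mul_left (2 * ((k + 1 : ℕ) : ℝ) ^ 2 + 5 * (k + 1 : ℕ) + 2)).sub
      (s1.mul_left (12 * ((k + 1 : ℕ) : ℝ) ^ 2 + 24 * (k + 1 : ℕ) + 10))).add
      (s0.mul_left (2 * ((k + 1 : ℕ) : ℝ) ^ 2 + 3 * (k + 1 : ℕ)))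
    have h := tsum_of_eq_sub hs (b16_recurrence k) (tendsto_cert (k + 1))
    rw [((s2.mul_left _).sub (s1.mul_left _)).tsum_add (s0.mul_left _),
      (s2.mul_left _).tsum_sub (s1.mul_left _), tsum_mul_left, tsum_mul_left, tsum_mul_left,
      show cert (k + 1) 0 = 0 by simp [cert], sub_zero] at h
    exact h
end

section
/- Let k ≥ 1 and n ≥ 1 be integers and let p be a real number with k/(k+1) < p ≤ 1. In the gambling game where at each round one wins one dollar with probability p and loses k dollars with probability 1−p, starting from 0, the expected number of rounds until the capital first reaches n equals n/( (p−1)k + p ). Explicitly, the series Σ_{m=0}^∞ ((k+1)m + n) · ( n/((k+1)m+n) )·C((k+1)m+n, m) · p^{km+n} (1−p)^m converges with sum n/( (p−1)k + p ). -/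
open Filter Topology

/-- The probability that the walk with steps `+1` (probability `p`) and `-k` (probability `q`),
started at `0`, is at `x` after `N` steps. -/
noncomputable def walkProb (k : ℕ) (p q : ℝ) : ℕ → ℤ → ℝ
  | 0, x => if x = 0 then 1 else 0
  | N + 1, x => p * walkProb k p q N (x - 1) + q * walkProb k p q N (x + k)

/-- The expected number of visits to `x` of the walk with steps `+1` and `-k`. -/
noncomputable def walkGreen (k : ℕ) (p q : ℝ) (x : ℤ) : ℝ :=
  ∑' N, walkProb k p q N x

section

variable {k : ℕ} {p q a : ℝ}

lemma exists_of_walkProb_ne_zero {N : ℕ} {x : ℤ} (h : walkProb k p q N x ≠ 0) :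
    ∃ m : ℕ, (N : ℤ) = (k + 1) * m + x := by
  induction N generalizing x with
  | zero =>
    refine ⟨0, ?_⟩
    by_contra hx
    exact h (if_neg fun h0 => hx (by simp [h0]))
  | succ N ih =>
    by_cases h1 : walkProb k p q N (x - 1) = 0
    · by_cases h2 : walkProb k p q N (x + k) = 0
      · simp [walkProb, h1, h2] at h
      · obtain ⟨m, hm⟩ := ih h2
        exact ⟨m + 1, by push_cast; linarith⟩
    · obtain ⟨m, hm⟩ := ih h1
      exact ⟨m, by push_cast; linarith⟩

lemma walkProb_eq_choose (N m : ℕ) (x : ℤ) (h : (N : ℤ) = (k + 1) * m + x) :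
    walkProb k p q N x = N.choose m * p ^ (N - m) * q ^ m := by
  induction N generalizing m x with
  | zero =>
    rcases m with _ | m
    · have hx : x = 0 := by simpa using h.symm
      simp [walkProb, hx]
    · have hx : x ≠ 0 := by
        rintro rfl
        have : ((k : ℤ) + 1) * ((m : ℤ) + 1) > 0 := by positivity
        push_cast at h
        linarith
      simp [walkProb, hx]
  | succ N ih =>
    rw [walkProb, ih m (x - 1) (by push_cast at h; linarith)]
    rcases m with _ | m
    · have h0 : walkProb k p q N (x + k) = 0 := by
        by_contra hne
        obtain ⟨m, hm⟩ := exists_of_walkProb_ne_zero hne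
        have : 0 ≤ ((k : ℤ) + 1) * m := by positivity
        push_cast at h
        simp only [mul_zero] at h
        have hk0 : (0 : ℤ) ≤ k := by positivity
        linarith
      rw [h0]
      simp [pow_succ']
    · rw [ih m (x + k) (by push_cast at h ⊢; linarith), Nat.choose_succ_succ]
      rcases lt_or_ge m N with hm | hm
      · obtain ⟨d, rfl⟩ := Nat.exists_eq_add_of_lt hm
        rw [show m + d + 1 - (m + 1) = d by omega, show m + d + 1 - m = d + 1 by omega,
          show m + d + 1 + 1 - (m + 1) = d + 1 by omega]
        push_cast
        ring
      · rw [Nat.choose_eq_zero_of_lt (show N < m + 1 by omega),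
          show N + 1 - (m + 1) = N - m by omega]
        push_cast
        ring

lemma walkProb_nonneg (hp : 0 ≤ p) (hq : 0 ≤ q) (N : ℕ) (x : ℤ) : 0 ≤ walkProb k p q N x := by
  induction N generalizing x with
  | zero => rw [walkProb]; split_ifs <;> norm_num
  | succ N ih => exact add_nonneg (mul_nonneg hp (ih _)) (mul_nonneg hq (ih _))

lemma walkProb_le (hp : 0 ≤ p) (hq : 0 ≤ q) (ha : 0 < a) (N : ℕ) (x : ℤ) :
    walkProb k p q N x ≤ a ^ x * (p * a⁻¹ + q * a ^ k) ^ N := by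
  induction N generalizing x with
  | zero =>
    rw [walkProb]
    split_ifs with h
    · simp [h]
    · positivity
  | succ N ih =>
    calc walkProb k p q (N + 1) x
        ≤ p * (a ^ (x - 1) * (p * a⁻¹ + q * a ^ k) ^ N)
          + q * (a ^ (x + k) * (p * a⁻¹ + q * a ^ k) ^ N) :=
          add_le_add (mul_le_mul_of_nonneg_left (ih _) hp) (mul_le_mul_of_nonneg_left (ih _) hq)
      _ = a ^ x * (p * a⁻¹ + q * a ^ k) ^ (N + 1) := by
          rw [zpow_sub_one₀ ha.ne', zpow_add₀ ha.ne', zpow_natCast]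
          ring

lemma exists_one_lt_mul_pow_lt (h : k * q < p) : ∃ a : ℝ, 1 < a ∧ k * q * a ^ k < p := by
  have hc : ContinuousAt (fun a : ℝ => k * q * a ^ k) 1 := by fun_prop
  have he : ∀ᶠ a in 𝓝[>] (1 : ℝ), k * q * a ^ k < p :=
    (hc.eventually_lt_const (by simpa using h)).filter_mono nhdsWithin_le_nhds
  obtain ⟨a, ha, ha1⟩ := (he.and self_mem_nhdsWithin).exists
  exact ⟨a, ha1, ha⟩

lemma exponentialMoment_lt_one (hq : 0 ≤ q) (hpq : p + q = 1) (ha : 1 < a)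
    (h : k * q * a ^ k < p) : p * a⁻¹ + q * a ^ k < 1 := by
  have ha0 : 0 < a := by linarith
  have hy : a⁻¹ < 1 := inv_lt_one_of_one_lt₀ ha
  have hy0 : 0 < a⁻¹ := inv_pos.2 ha0
  have hb := one_add_mul_le_pow (show (-2 : ℝ) ≤ a⁻¹ - 1 by linarith) k
  rw [add_sub_cancel] at hb
  have hak : a⁻¹ ^ k * a ^ k = 1 := by rw [← mul_pow, inv_mul_cancel₀ ha0.ne', one_pow]
  have h1 : a ^ k - 1 ≤ k * (1 - a⁻¹) * a ^ k := by
    have := mul_le_mul_of_nonneg_right hb (pow_nonneg ha0.le k)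
    rw [hak] at this
    linarith
  have h2 := mul_le_mul_of_nonneg_left h1 hq
  have h3 := mul_lt_mul_of_pos_right h (sub_pos.2 hy)
  linarith

lemma summable_walkProb (hp : 0 ≤ p) (hq : 0 ≤ q) (ha : 0 < a) (hr : p * a⁻¹ + q * a ^ k < 1)
    (x : ℤ) : Summable fun N => walkProb k p q N x :=
  Summable.of_nonneg_of_le (fun N => walkProb_nonneg hp hq N x)
    (fun N => walkProb_le hp hq ha N x)
    ((summable_geometric_of_lt_one (by positivity) hr).mul_left _)

lemma walkGreen_nonneg (hp : 0 ≤ p) (hq : 0 ≤ q) (x : ℤ) : 0 ≤ walkGreen k p q x :=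
  tsum_nonneg fun N => walkProb_nonneg hp hq N x

lemma walkGreen_le (hp : 0 ≤ p) (hq : 0 ≤ q) (ha : 0 < a) (hr : p * a⁻¹ + q * a ^ k < 1)
    (x : ℤ) : walkGreen k p q x ≤ a ^ x * (1 - (p * a⁻¹ + q * a ^ k))⁻¹ := by
  rw [← tsum_geometric_of_lt_one (by positivity) hr, ← tsum_mul_left]
  exact (summable_walkProb hp hq ha hr x).tsum_le_tsum (fun N => walkProb_le hp hq ha N x)
    ((summable_geometric_of_lt_one (by positivity) hr).mul_left _)

lemma walkGreen_eq (hs : ∀ x, Summable fun N => walkProb k p q N x) (x : ℤ) :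
    walkGreen k p q x = (if x = 0 then 1 else 0)
      + (p * walkGreen k p q (x - 1) + q * walkGreen k p q (x + k)) := by
  rw [walkGreen, (hs x).tsum_eq_zero_add, walkProb]
  simp only [walkProb]
  rw [((hs _).mul_left p).tsum_add ((hs _).mul_left q), tsum_mul_left, tsum_mul_left]
  rfl

lemma tendsto_walkGreen_atBot (hp : 0 ≤ p) (hq : 0 ≤ q) (ha : 1 < a)
    (hr : p * a⁻¹ + q * a ^ k < 1) : Tendsto (walkGreen k p q) atBot (𝓝 0) := by
  have hz : Tendsto (fun x : ℤ => a ^ x) atBot (𝓝 0) := by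
    have h1 : Tendsto (fun x : ℝ => a ^ x) atBot (𝓝 0) := tendsto_rpow_atBot_of_base_gt_one a ha
    simpa only [Function.comp_def, Real.rpow_intCast, id] using
      h1.comp (tendsto_intCast_atBot_iff.2 tendsto_id)
  refine squeeze_zero (walkGreen_nonneg hp hq)
    (walkGreen_le hp hq (by linarith) hr) ?_
  simpa using hz.mul_const (1 - (p * a⁻¹ + q * a ^ k))⁻¹

/-- The expected net number of crossings from `x` to `x + 1` is `1` for every `x ≥ 0`. -/
lemma walkGreen_flux (hp : 0 ≤ p) (hq : 0 ≤ q) (hpq : p + q = 1) (ha : 1 < a)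
    (hr : p * a⁻¹ + q * a ^ k < 1) (n : ℕ) :
    p * walkGreen k p q n - q * ∑ i ∈ Finset.range k, walkGreen k p q (n + (i + 1)) = 1 := by
  set G := walkGreen k p q with hG
  set c : ℤ → ℝ := fun x => p * G x - q * ∑ i ∈ Finset.range k, G (x + (i + 1)) with hc
  have hstep (x : ℤ) : c x = (if x = 0 then 1 else 0) + c (x - 1) := by
    have h1 := walkGreen_eq (summable_walkProb hp hq (by linarith) hr) x
    have h2 : ∑ i ∈ Finset.range k, G (x - 1 + (i + 1)) + G (x + k)
        = ∑ i ∈ Finset.range k, G (x + (i + 1)) + G x := by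
      have h3 := Finset.sum_range_succ (fun i : ℕ => G (x + i)) k
      have h4 := Finset.sum_range_succ' (fun i : ℕ => G (x + i)) k
      simp only [Nat.cast_add, Nat.cast_one, Nat.cast_zero, add_zero] at h4
      rw [← h4, h3]
      congr 1
      exact Finset.sum_congr rfl fun i _ => by congr 1; ring
    simp only [hc]
    rw [← hG] at h1
    linear_combination h1 + q * h2 + G x * hpq
  have hlim : Tendsto c atBot (𝓝 0) := by
    have hG0 : Tendsto G atBot (𝓝 0) := tendsto_walkGreen_atBot hp hq ha hr
    have hsum : Tendsto (fun x : ℤ => ∑ i ∈ Finset.range k, G (x + (i + 1))) atBot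
        (𝓝 (∑ i ∈ Finset.range k, 0)) :=
      tendsto_finsetSum _ fun i _ =>
        hG0.comp (tendsto_atBot_add_const_right _ _ tendsto_id)
    simpa using (hG0.const_mul p).sub (hsum.const_mul q)
  have hneg (j : ℕ) : c (-1 - j) = c (-1) := by
    induction j with
    | zero => simp
    | succ j ih =>
      have h := hstep (-1 - j)
      rw [if_neg (by omega), zero_add] at h
      rw [← ih, h]
      push_cast
      congr 1
      ring
  have hneg0 : c (-1) = 0 := by
    have ht : Tendsto (fun j : ℕ => (-1 : ℤ) - j) atTop atBot :=
      tendsto_atBot.2 fun b => (eventually_ge_atTop b.natAbs).mono fun j hj => by omega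
    refine tendsto_nhds_unique ?_ (hlim.comp ht)
    simp only [Function.comp_def, hneg]
    exact tendsto_const_nhds
  change c n = 1
  induction n with
  | zero => simpa [hneg0] using hstep 0
  | succ n ih =>
    have h := hstep ((n + 1 : ℕ) : ℤ)
    rw [if_neg (by omega), zero_add] at h
    rw [h, ← ih]
    push_cast
    congr 1
    ring

/-- A sequence of small exponential growth solving `p E(n) = q (E(n+1) + ⋯ + E(n+k))` vanishes. -/
lemma eq_zero_of_mul_eq_mul_sum {E : ℕ → ℝ} {C : ℝ} (hp : 0 < p) (hq : 0 ≤ q) (ha : 1 ≤ a)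
    (h : k * q * a ^ k < p)
    (hE : ∀ n, p * E n = q * ∑ i ∈ Finset.range k, E (n + (i + 1)))
    (hC : ∀ n, |E n| ≤ C * a ^ n) (n : ℕ) : E n = 0 := by
  have ha0 : 0 < a := by linarith
  have hC0 : 0 ≤ C := by simpa using (abs_nonneg _).trans (hC 0)
  set r := k * q * a ^ k / p with hr
  have hr0 : 0 ≤ r := by positivity
  have hr1 : r < 1 := (div_lt_one hp).2 h
  have key (j : ℕ) : ∀ n, |E n| ≤ C * r ^ j * a ^ n := by
    induction j with
    | zero => simpa using hC
    | succ j ih =>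
      intro n
      have hsum : ∑ i ∈ Finset.range k, |E (n + (i + 1))| ≤ k * (C * r ^ j * a ^ (n + k)) := by
        rw [← nsmul_eq_mul]
        nth_rewrite 2 [← Finset.card_range k]
        refine Finset.sum_le_card_nsmul _ _ _ fun i hi => (ih _).trans ?_
        have := Finset.mem_range.1 hi
        exact mul_le_mul_of_nonneg_left (pow_le_pow_right₀ ha (by omega)) (by positivity)
      have h1 : p * |E n| ≤ q * (k * (C * r ^ j * a ^ (n + k))) := by
        calc p * |E n| = |p * E n| := by rw [abs_mul, abs_of_pos hp]
          _ = q * |∑ i ∈ Finset.range k, E (n + (i + 1))| := by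
            rw [hE, abs_mul, abs_of_nonneg hq]
          _ ≤ _ := mul_le_mul_of_nonneg_left ((Finset.abs_sum_le_sum_abs _ _).trans hsum) hq
      refine le_of_mul_le_mul_left (h1.trans_eq ?_) hp
      have hpr : p * r = k * q * a ^ k := by rw [hr]; field_simp
      rw [pow_add, pow_succ]
      linear_combination -(C * r ^ j * a ^ n) * hpr
  have hlim : Tendsto (fun j : ℕ => C * r ^ j * a ^ n) atTop (𝓝 0) := by
    simpa using ((tendsto_pow_atTop_nhds_zero_of_lt_one hr0 hr1).const_mul C).mul_const (a ^ n)
  exact abs_nonpos_iff.1 (ge_of_tendsto' hlim fun j => key j n)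

lemma walkGreen_natCast (hp : 0 < p) (hq : 0 ≤ q) (hpq : p + q = 1) (ha : 1 < a)
    (h : k * q * a ^ k < p) (n : ℕ) : walkGreen k p q n = (p - k * q)⁻¹ := by
  have ha0 : 0 < a := by linarith
  have hr := exponentialMoment_lt_one hq hpq ha h
  have hd : 0 < p - k * q := by
    have := le_mul_of_one_le_right (by positivity : 0 ≤ k * q) (one_le_pow₀ ha.le (n := k))
    linarith
  refine sub_eq_zero.1 (eq_zero_of_mul_eq_mul_sum
    (E := fun n : ℕ => walkGreen k p q n - (p - k * q)⁻¹)
    (C := (1 - (p * a⁻¹ + q * a ^ k))⁻¹ + (p - k * q)⁻¹) hp hq ha.le h ?_ ?_ n)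
  · intro n
    have hf := walkGreen_flux hp.le hq hpq ha hr n
    have hi : (p - k * q) * (p - k * q)⁻¹ = 1 := mul_inv_cancel₀ hd.ne'
    simp only [Finset.sum_sub_distrib, Finset.sum_const, Finset.card_range, nsmul_eq_mul]
    push_cast
    linear_combination hf - hi
  · intro n
    have h1 := walkGreen_le hp.le hq ha0 hr n
    have h2 := walkGreen_nonneg (k := k) hp.le hq n
    have h3 := le_mul_of_one_le_right (inv_pos.2 hd).le (one_le_pow₀ ha.le (n := n))
    rw [zpow_natCast] at h1
    refine (abs_sub _ _).trans ?_
    rw [abs_of_nonneg h2, abs_of_pos (inv_pos.2 hd)]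
    linarith

lemma hasSum_choose_mul_pow (hp : 0 < p) (hq : 0 ≤ q) (hpq : p + q = 1) (h : k * q < p) (n : ℕ) :
    HasSum (fun m : ℕ => (((k + 1) * m + n).choose m : ℝ) * p ^ (k * m + n) * q ^ m)
      (p - k * q)⁻¹ := by
  obtain ⟨a, ha, hak⟩ := exists_one_lt_mul_pow_lt h
  have hs := (summable_walkProb hp.le hq (by linarith)
    (exponentialMoment_lt_one hq hpq ha hak) (n : ℤ)).hasSum
  change HasSum _ (walkGreen k p q n) at hs
  rw [walkGreen_natCast hp hq hpq ha hak] at hs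
  have hinj : Function.Injective fun m : ℕ => (k + 1) * m + n := fun m m' hm =>
    Nat.eq_of_mul_eq_mul_left k.succ_pos (Nat.add_right_cancel hm)
  rw [← hinj.hasSum_iff] at hs
  · convert hs using 2 with m
    rw [Function.comp_apply, walkProb_eq_choose _ m n (by push_cast; ring),
      show (k + 1) * m + n - m = k * m + n by rw [add_one_mul]; omega]
  · intro N hN
    by_contra hne
    obtain ⟨m, hm⟩ := exists_of_walkProb_ne_zero hne
    exact hN ⟨m, by dsimp only; exact_mod_cast hm.symm⟩

end


/-- For k ≥ 1, n ≥ 1 and k/(k+1) < p ≤ 1, in the gambling game that wins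
one dollar with probability p and loses k dollars with probability 1−p, the expected
number of rounds until the capital first reaches n equals n/((p−1)k + p):
`Σ_{m≥0} ((k+1)m+n)·(n/((k+1)m+n))·C((k+1)m+n, m)·p^{km+n}(1−p)^m = n/((p−1)k+p)`. -/
theorem expected_duration_fuss_catalan_walk (k n : ℕ) (hk : 1 ≤ k) (hn : 1 ≤ n)
    (p : ℝ) (hp : (k : ℝ) / ((k : ℝ) + 1) < p) (hp1 : p ≤ 1) :
    HasSum
      (fun m : ℕ =>
        (((k + 1) * m + n : ℕ) : ℝ) *
          ((n : ℝ) / (((k + 1) * m + n : ℕ) : ℝ) * (Nat.choose ((k + 1) * m + n) m : ℝ)) *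
          p ^ (k * m + n) * (1 - p) ^ m)
      ((n : ℝ) / ((p - 1) * (k : ℝ) + p)) := by
  have hk0 : (0 : ℝ) < (k : ℝ) + 1 := by positivity
  have hp0 : 0 < p := lt_of_le_of_lt (by positivity) hp
  have hd : k * (1 - p) < p := by
    rw [div_lt_iff₀ hk0] at hp
    linarith
  have hsum := (hasSum_choose_mul_pow hp0 (sub_nonneg.2 hp1) (by ring) hd n).mul_left (n : ℝ)
  rw [← div_eq_mul_inv, show p - k * (1 - p) = (p - 1) * k + p by ring] at hsum
  refine (congrArg (HasSum · _) (funext fun m => ?_)).mp hsum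
  have hN : (((k + 1) * m + n : ℕ) : ℝ) ≠ 0 := by
    have : (k + 1) * m + n ≠ 0 := by omega
    exact_mod_cast this
  rw [← mul_assoc _ (_ / _), mul_div_cancel₀ _ hN]
  ring
end

section
/- Let p be a real number with 0 < p < 2/3. Consider the walk on ℤ starting at 0 which at each round moves −1 with probability p and +2 with probability 1−p, and for j ≥ 1 let a_j = Σ p^{d(w)} (1−p)^{u(w)}, the sum over all words w ∈ {−1, 2}^j whose proper prefix sums are all ≤ 0 and whose total sum is ≥ 1, where d(w) and u(w) are the numbers of entries of w equal to −1 and to 2 respectively (so a_j is the probability of first reaching a positive position at round j). Then the series Σ_{j=1}^∞ j·a_j converges and its sum equals ( 3p + √((3p+1)(1−p)) − 1 ) / ( 2p(2 − 3p) ). In particular, for p = 1/2 the expected duration is 1 + √5, twice the golden ratio. -/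
/-- `a18 p j` : the probability that the walk on ℤ starting at 0, stepping −1 with
probability p and +2 with probability 1−p, first reaches a strictly positive position at
exactly round j: the sum over words `w ∈ {−1,2}^j` with all proper prefix sums ≤ 0 and
total sum ≥ 1 of `p^{d(w)}·(1−p)^{u(w)}`, where `d(w)` and `u(w)` count the entries equal
to −1 and to 2. -/
noncomputable def a18 (p : ℝ) (j : ℕ) : ℝ :=
  ∑ w ∈ Finset.univ.filter (fun w : Fin j → ({-1, 2} : Finset ℤ) =>
      (∀ jj : ℕ, jj < j →
        (∑ i ∈ Finset.univ.filter (fun i : Fin j => (i : ℕ) < jj), (w i : ℤ)) ≤ 0) ∧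
      1 ≤ ∑ i : Fin j, (w i : ℤ)),
    p ^ (Finset.univ.filter (fun i : Fin j => (w i : ℤ) = -1)).card *
      (1 - p) ^ (Finset.univ.filter (fun i : Fin j => (w i : ℤ) = 2)).card

open Finset Filter Topology

/-! ### Words in the steps `-1` and `2` -/

/-- The sum of the first `k` entries of a word. -/
def prefixSum {j : ℕ} (w : Fin j → ({-1, 2} : Finset ℤ)) (k : ℕ) : ℤ :=
  ∑ i ∈ univ.filter (fun i : Fin j => (i : ℕ) < k), (w i : ℤ)

/-- The probability of a word whose entries are independent, equal to `-1` with probability `p`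
and to `2` with probability `1 - p`. -/
def wordWeight (p : ℝ) {j : ℕ} (w : Fin j → ({-1, 2} : Finset ℤ)) : ℝ :=
  ∏ i, if (w i : ℤ) = -1 then p else 1 - p

/-- The probability that the walk stays nonpositive up to time `j` and is at `-s` at time `j`. -/
def survivalMass (p : ℝ) (j s : ℕ) : ℝ :=
  ∑ w : Fin j → ({-1, 2} : Finset ℤ),
    if (∀ k ≤ j, prefixSum w k ≤ 0) ∧ ∑ i, (w i : ℤ) = -(s : ℤ) then wordWeight p w else 0

theorem wordWeight_eq_pow_mul_pow (p : ℝ) {j : ℕ} (w : Fin j → ({-1, 2} : Finset ℤ)) :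
    wordWeight p w =
      p ^ (univ.filter (fun i : Fin j => (w i : ℤ) = -1)).card *
        (1 - p) ^ (univ.filter (fun i : Fin j => (w i : ℤ) = 2)).card := by
  have h : univ.filter (fun i : Fin j => ¬ (w i : ℤ) = -1) =
      univ.filter (fun i : Fin j => (w i : ℤ) = 2) := by
    refine filter_congr fun i _ => ?_
    have := (w i).2
    simp only [mem_insert, mem_singleton] at this
    lia
  rw [wordWeight, prod_ite, prod_const, prod_const, h]

theorem wordWeight_nonneg {p : ℝ} (hp0 : 0 ≤ p) (hp1 : p ≤ 1) {j : ℕ}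
    (w : Fin j → ({-1, 2} : Finset ℤ)) : 0 ≤ wordWeight p w :=
  prod_nonneg fun i _ => by split_ifs <;> linarith

theorem wordWeight_snoc (p : ℝ) {j : ℕ} (w : Fin j → ({-1, 2} : Finset ℤ))
    (x : ({-1, 2} : Finset ℤ)) :
    wordWeight p (Fin.snoc (α := fun _ => ({-1, 2} : Finset ℤ)) w x) =
      wordWeight p w * if (x : ℤ) = -1 then p else 1 - p := by
  simp [wordWeight, Fin.prod_univ_castSucc]

theorem sum_snoc {j : ℕ} (w : Fin j → ({-1, 2} : Finset ℤ)) (x : ({-1, 2} : Finset ℤ)) :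
    ∑ i, ((Fin.snoc (α := fun _ => ({-1, 2} : Finset ℤ)) w x i : ({-1, 2} : Finset ℤ)) : ℤ) =
      ∑ i, (w i : ℤ) + x := by
  simp [Fin.sum_univ_castSucc]

theorem prefixSum_snoc {j k : ℕ} (hk : k ≤ j) (w : Fin j → ({-1, 2} : Finset ℤ))
    (x : ({-1, 2} : Finset ℤ)) :
    prefixSum (Fin.snoc (α := fun _ => ({-1, 2} : Finset ℤ)) w x) k = prefixSum w k := by
  simp [prefixSum, sum_filter, Fin.sum_univ_castSucc, hk]

theorem prefixSum_self {j : ℕ} (w : Fin j → ({-1, 2} : Finset ℤ)) :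
    prefixSum w j = ∑ i, (w i : ℤ) := by
  simp [prefixSum]

theorem sum_words_succ_s18 {j : ℕ} (F : (Fin (j + 1) → ({-1, 2} : Finset ℤ)) → ℝ) :
    ∑ w, F w =
      ∑ w : Fin j → ({-1, 2} : Finset ℤ),
        (F (Fin.snoc (α := fun _ => ({-1, 2} : Finset ℤ)) w ⟨-1, by simp⟩) +
          F (Fin.snoc (α := fun _ => ({-1, 2} : Finset ℤ)) w ⟨2, by simp⟩)) := by
  have hu : (univ : Finset ({-1, 2} : Finset ℤ)) = {⟨-1, by simp⟩, ⟨2, by simp⟩} := by decide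
  rw [← (Fin.snocEquiv fun _ : Fin (j + 1) => ({-1, 2} : Finset ℤ)).sum_comp,
    Fintype.sum_prod_type, sum_comm]
  refine sum_congr rfl fun w _ => ?_
  rw [hu, sum_pair (by simp)]
  rfl

theorem forall_prefixSum_snoc_nonpos_iff {j : ℕ} (w : Fin j → ({-1, 2} : Finset ℤ))
    (x : ({-1, 2} : Finset ℤ)) :
    (∀ k ≤ j, prefixSum (Fin.snoc (α := fun _ => ({-1, 2} : Finset ℤ)) w x) k ≤ 0) ↔
      ∀ k ≤ j, prefixSum w k ≤ 0 :=
  forall₂_congr fun k hk => by rw [prefixSum_snoc hk]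

theorem forall_prefixSum_succ_nonpos_iff {j : ℕ} (w : Fin (j + 1) → ({-1, 2} : Finset ℤ)) :
    (∀ k ≤ j + 1, prefixSum w k ≤ 0) ↔
      (∀ k ≤ j, prefixSum w k ≤ 0) ∧ ∑ i, (w i : ℤ) ≤ 0 := by
  rw [← prefixSum_self]
  refine ⟨fun h => ⟨fun k hk => h k (by lia), h _ le_rfl⟩, fun h k hk => ?_⟩
  rcases Nat.le_succ_iff.1 hk with hk | rfl
  exacts [h.1 k hk, h.2]

/-! ### The survival masses -/

theorem survivalMass_nonneg {p : ℝ} (hp0 : 0 ≤ p) (hp1 : p ≤ 1) (j s : ℕ) :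
    0 ≤ survivalMass p j s :=
  sum_nonneg fun w _ => by
    split_ifs
    exacts [wordWeight_nonneg hp0 hp1 w, le_rfl]

theorem survivalMass_zero (p : ℝ) (s : ℕ) : survivalMass p 0 s = if s = 0 then 1 else 0 := by
  simp [survivalMass, prefixSum, wordWeight, eq_comm]

theorem survivalMass_succ_zero (p : ℝ) (j : ℕ) :
    survivalMass p (j + 1) 0 = (1 - p) * survivalMass p j 2 := by
  rw [survivalMass, sum_words_succ_s18, survivalMass, mul_sum]
  refine sum_congr rfl fun w _ => ?_
  simp only [forall_prefixSum_succ_nonpos_iff, forall_prefixSum_snoc_nonpos_iff, sum_snoc,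
    wordWeight_snoc]
  by_cases h : ∀ k ≤ j, prefixSum w k ≤ 0
  · have h' := h j le_rfl
    rw [prefixSum_self] at h'
    have hd : ¬ ∑ i, (w i : ℤ) = 1 := by lia
    grind
  · simp [h]

theorem survivalMass_succ_succ (p : ℝ) (j s : ℕ) :
    survivalMass p (j + 1) (s + 1) =
      p * survivalMass p j s + (1 - p) * survivalMass p j (s + 3) := by
  rw [survivalMass, sum_words_succ_s18, survivalMass, survivalMass, mul_sum, mul_sum,
    ← sum_add_distrib]
  refine sum_congr rfl fun w _ => ?_
  simp only [forall_prefixSum_succ_nonpos_iff, forall_prefixSum_snoc_nonpos_iff, sum_snoc,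
    wordWeight_snoc]
  by_cases h : ∀ k ≤ j, prefixSum w k ≤ 0
  · push_cast
    grind
  · simp [h]

theorem a18_eq_sum_wordWeight (p : ℝ) (j : ℕ) :
    a18 p j = ∑ w : Fin j → ({-1, 2} : Finset ℤ),
      if (∀ k < j, prefixSum w k ≤ 0) ∧ 1 ≤ ∑ i, (w i : ℤ) then wordWeight p w else 0 := by
  rw [a18, sum_filter]
  simp only [wordWeight_eq_pow_mul_pow, prefixSum]

theorem a18_nonneg {p : ℝ} (hp0 : 0 ≤ p) (hp1 : p ≤ 1) (j : ℕ) : 0 ≤ a18 p j := by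
  rw [a18_eq_sum_wordWeight]
  refine sum_nonneg fun w _ => ?_
  split_ifs
  exacts [wordWeight_nonneg hp0 hp1 w, le_rfl]

theorem a18_succ (p : ℝ) (j : ℕ) :
    a18 p (j + 1) = (1 - p) * (survivalMass p j 0 + survivalMass p j 1) := by
  rw [a18_eq_sum_wordWeight, sum_words_succ_s18, survivalMass, survivalMass, ← sum_add_distrib,
    mul_sum]
  refine sum_congr rfl fun w _ => ?_
  simp only [Nat.lt_succ_iff, forall_prefixSum_snoc_nonpos_iff, sum_snoc, wordWeight_snoc]
  by_cases h : ∀ k ≤ j, prefixSum w k ≤ 0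
  · have h' := h j le_rfl
    rw [prefixSum_self] at h'
    push_cast
    grind
  · simp [h]

/-! ### The expected number of visits -/

section Visits

variable {p r c : ℝ}

theorem sum_range_survivalMass_le (hp0 : 0 ≤ p) (hp1 : p ≤ 1) (hr0 : 0 ≤ r) (hc0 : 0 ≤ c)
    (hr : (1 - p) * r ^ 2 + (1 - p) * r = p) (hc : c = 1 + (1 - p) * (c * r ^ 2)) (n s : ℕ) :
    ∑ j ∈ range n, survivalMass p j s ≤ c * r ^ s := by
  induction n generalizing s with
  | zero => simpa using by positivity
  | succ n ih =>
    rw [sum_range_succ', survivalMass_zero]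
    cases s with
    | zero =>
      simp only [survivalMass_succ_zero, ← mul_sum, if_true]
      have := mul_le_mul_of_nonneg_left (ih 2) (sub_nonneg.2 hp1)
      linarith
    | succ s =>
      simp only [survivalMass_succ_succ, sum_add_distrib, ← mul_sum]
      have h₁ := mul_le_mul_of_nonneg_left (ih s) hp0
      have h₂ := mul_le_mul_of_nonneg_left (ih (s + 3)) (sub_nonneg.2 hp1)
      have h₃ : c * r ^ (s + 1) = p * (c * r ^ s) + (1 - p) * (c * r ^ (s + 3)) := by
        linear_combination (-c * r ^ s * (r - 1)) * hr
      simp only [Nat.succ_ne_zero, if_false]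
      linarith

theorem summable_survivalMass (hp0 : 0 ≤ p) (hp1 : p ≤ 1) (hr0 : 0 ≤ r) (hc0 : 0 ≤ c)
    (hr : (1 - p) * r ^ 2 + (1 - p) * r = p) (hc : c = 1 + (1 - p) * (c * r ^ 2)) (s : ℕ) :
    Summable fun j => survivalMass p j s :=
  summable_of_sum_range_le (fun j => survivalMass_nonneg hp0 hp1 j s)
    fun n => sum_range_survivalMass_le hp0 hp1 hr0 hc0 hr hc n s

/-- A summable solution of the homogeneous recursion satisfied by the expected numbers of visits
which is nonnegative vanishes identically. -/
theorem eq_zero_of_visit_recursion {D : ℕ → ℝ} (hp1 : p < 1) (hD : Summable D)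
    (hD0 : ∀ s, 0 ≤ D s) (hzero : D 0 = (1 - p) * D 2)
    (hsucc : ∀ s, D (s + 1) = p * D s + (1 - p) * D (s + 3)) (s : ℕ) : D s = 0 := by
  have hq : 1 - p ≠ 0 := (sub_pos.2 hp1).ne'
  have h₁ := hD.sum_add_tsum_nat_add 1
  have h₃ := hD.sum_add_tsum_nat_add 3
  have h : ∑' s, D (s + 1) = p * ∑' s, D s + (1 - p) * ∑' s, D (s + 3) := by
    rw [← tsum_mul_left, ← tsum_mul_left, ← Summable.tsum_add (hD.mul_left p)
      (((summable_nat_add_iff 3).2 hD).mul_left _)]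
    exact tsum_congr hsucc
  simp only [sum_range_succ, range_zero, sum_empty, zero_add] at h₁ h₃
  have h₀₁ : (1 - p) * (D 0 + D 1) = 0 := by
    linear_combination h - h₁ + (1 - p) * h₃ + hzero
  have h₀₁ := (mul_eq_zero.1 h₀₁).resolve_left hq
  have hD₀ : D 0 = 0 := by linarith [hD0 0, hD0 1]
  have hD₁ : D 1 = 0 := by linarith [hD0 0, hD0 1]
  have hD₂ : D 2 = 0 := by
    rw [hD₀] at hzero
    exact (mul_eq_zero.1 hzero.symm).resolve_left hq
  have key : D s = 0 ∧ D (s + 1) = 0 ∧ D (s + 2) = 0 := by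
    induction s with
    | zero => exact ⟨hD₀, hD₁, hD₂⟩
    | succ s ih =>
      have hs := hsucc s
      rw [ih.1, ih.2.1, mul_zero, zero_add] at hs
      exact ⟨ih.2.1, ih.2.2, (mul_eq_zero.1 hs.symm).resolve_left hq⟩
  exact key.1

theorem tsum_survivalMass (hp0 : 0 ≤ p) (hp1 : p < 1) (hr0 : 0 ≤ r) (hr1 : r < 1) (hc0 : 0 ≤ c)
    (hr : (1 - p) * r ^ 2 + (1 - p) * r = p) (hc : c = 1 + (1 - p) * (c * r ^ 2)) (s : ℕ) :
    ∑' j, survivalMass p j s = c * r ^ s := by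
  have hsum := summable_survivalMass hp0 hp1.le hr0 hc0 hr hc
  have hle (s) : ∑' j, survivalMass p j s ≤ c * r ^ s :=
    Real.tsum_le_of_sum_range_le (fun j => survivalMass_nonneg hp0 hp1.le j s)
      fun n => sum_range_survivalMass_le hp0 hp1.le hr0 hc0 hr hc n s
  have hnn (s) : 0 ≤ ∑' j, survivalMass p j s :=
    tsum_nonneg fun j => survivalMass_nonneg hp0 hp1.le j s
  have hgeo : Summable fun s => c * r ^ s := (summable_geometric_of_lt_one hr0 hr1).mul_left c
  have hzero : ∑' j, survivalMass p j 0 = 1 + (1 - p) * ∑' j, survivalMass p j 2 := by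
    rw [(hsum 0).tsum_eq_zero_add, survivalMass_zero, if_pos rfl, ← tsum_mul_left]
    simp only [survivalMass_succ_zero]
  have hsucc (s) : ∑' j, survivalMass p j (s + 1) =
      p * ∑' j, survivalMass p j s + (1 - p) * ∑' j, survivalMass p j (s + 3) := by
    rw [(hsum _).tsum_eq_zero_add, survivalMass_zero, if_neg s.succ_ne_zero, zero_add,
      ← tsum_mul_left, ← tsum_mul_left,
      ← Summable.tsum_add ((hsum s).mul_left p) ((hsum (s + 3)).mul_left (1 - p))]
    simp only [survivalMass_succ_succ]
  have := eq_zero_of_visit_recursion (D := fun s => c * r ^ s - ∑' j, survivalMass p j s) hp1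
    (hgeo.sub (hgeo.of_nonneg_of_le hnn hle)) (fun s => sub_nonneg.2 (hle s))
    (by rw [hzero]; linear_combination hc)
    (fun s => by rw [hsucc]; linear_combination (-c * r ^ s * (r - 1)) * hr) s
  linarith

theorem summable_prod_survivalMass (hp0 : 0 ≤ p) (hp1 : p < 1) (hr0 : 0 ≤ r) (hr1 : r < 1)
    (hc0 : 0 ≤ c) (hr : (1 - p) * r ^ 2 + (1 - p) * r = p)
    (hc : c = 1 + (1 - p) * (c * r ^ 2)) :
    Summable fun x : ℕ × ℕ => survivalMass p x.1 x.2 := by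
  rw [← (Equiv.prodComm ℕ ℕ).summable_iff]
  refine (summable_prod_of_nonneg fun x => survivalMass_nonneg hp0 hp1.le _ _).2
    ⟨summable_survivalMass hp0 hp1.le hr0 hc0 hr hc, ?_⟩
  simp only [Equiv.prodComm_apply, Prod.fst_swap, Prod.snd_swap,
    tsum_survivalMass hp0 hp1 hr0 hr1 hc0 hr hc]
  exact (summable_geometric_of_lt_one hr0 hr1).mul_left c

/-- The tail probabilities of the duration sum to `c / (1 - r)`. -/
theorem hasSum_tsum_survivalMass (hp0 : 0 ≤ p) (hp1 : p < 1) (hr0 : 0 ≤ r) (hr1 : r < 1)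
    (hc0 : 0 ≤ c) (hr : (1 - p) * r ^ 2 + (1 - p) * r = p)
    (hc : c = 1 + (1 - p) * (c * r ^ 2)) :
    HasSum (fun j => ∑' s, survivalMass p j s) (c / (1 - r)) := by
  have h := summable_prod_survivalMass hp0 hp1 hr0 hr1 hc0 hr hc
  have hval : ∑' j, ∑' s, survivalMass p j s = c / (1 - r) := by
    rw [Summable.tsum_comm (f := fun s j => survivalMass p j s) h.prod_symm]
    simp only [tsum_survivalMass hp0 hp1 hr0 hr1 hc0 hr hc]
    rw [tsum_mul_left, tsum_geometric_of_lt_one hr0 hr1, div_eq_mul_inv]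
  exact hval ▸ h.prod.hasSum

end Visits

theorem a18_succ_eq_tsum_sub_tsum {p : ℝ} {j : ℕ} (h : Summable fun s => survivalMass p j s)
    (h' : Summable fun s => survivalMass p (j + 1) s) :
    a18 p (j + 1) = ∑' s, survivalMass p j s - ∑' s, survivalMass p (j + 1) s := by
  have h₃ := h.sum_add_tsum_nat_add 3
  simp only [sum_range_succ, range_zero, sum_empty, zero_add] at h₃
  rw [h'.tsum_eq_zero_add, survivalMass_succ_zero, a18_succ]
  simp only [survivalMass_succ_succ]
  rw [Summable.tsum_add (h.mul_left p) (((summable_nat_add_iff 3).2 h).mul_left _),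
    tsum_mul_left, tsum_mul_left]
  linear_combination (1 - p) * h₃

/-! ### Expectation as a sum of tail probabilities -/

/-- Olivier's theorem: a summable antitone nonnegative sequence is `o(1 / n)`, here under the
assumption that the limit of `n * t n` exists. -/
theorem eq_zero_of_tendsto_nat_mul {t : ℕ → ℝ} {L : ℝ} (ht : Antitone t) (ht0 : ∀ n, 0 ≤ t n)
    (hs : Summable t) (hL : Tendsto (fun n : ℕ => (n : ℝ) * t n) atTop (𝓝 L)) : L = 0 := by
  have h2 : Tendsto (fun n : ℕ => 2 * n) atTop atTop :=
    tendsto_id.const_mul_atTop' two_pos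
  have hP := hs.hasSum.tendsto_sum_nat
  have hdiff : Tendsto (fun n : ℕ => 2 * (∑ j ∈ range (2 * n), t j - ∑ j ∈ range n, t j)) atTop
      (𝓝 0) := by
    simpa using ((hP.comp h2).sub hP).const_mul 2
  refine tendsto_nhds_unique (hL.comp h2) (squeeze_zero (fun n => ?_) (fun n => ?_) hdiff)
  · exact mul_nonneg (Nat.cast_nonneg _) (ht0 _)
  · have : n • t (2 * n) ≤ ∑ j ∈ range n, t (n + j) := by
      simpa using card_nsmul_le_sum (range n) (fun j => t (n + j)) (t (2 * n))
        fun j hj => ht (by have := mem_range.1 hj; lia)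
    have hsplit := sum_range_add t n n
    rw [← two_mul] at hsplit
    simp only [hsplit, Function.comp_apply, Nat.cast_mul, Nat.cast_ofNat]
    rw [nsmul_eq_mul] at this
    linarith

theorem hasSum_nat_mul_of_tail {a t : ℕ → ℝ} {T : ℝ} (ha0 : ∀ n, 0 ≤ a n) (ht0 : ∀ n, 0 ≤ t n)
    (hat : ∀ n, a (n + 1) = t n - t (n + 1)) (hT : HasSum t T) :
    HasSum (fun n : ℕ => (n : ℝ) * a n) T := by
  have ht : Antitone t := antitone_nat_of_succ_le fun n => by linarith [ha0 (n + 1), hat n]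
  have hsum (n : ℕ) : ∑ j ∈ range (n + 1), (j : ℝ) * a j = ∑ j ∈ range n, t j - n * t n := by
    induction n with
    | zero => simp
    | succ n ih =>
      rw [sum_range_succ, ih, hat, sum_range_succ t]
      push_cast
      ring
  have hnn (n : ℕ) : 0 ≤ (n : ℝ) * a n := mul_nonneg n.cast_nonneg (ha0 n)
  have hs : Summable fun n : ℕ => (n : ℝ) * a n := by
    refine summable_of_sum_range_le (c := T) hnn fun n => ?_
    have h₁ : ∑ j ∈ range n, (j : ℝ) * a j ≤ ∑ j ∈ range (n + 1), (j : ℝ) * a j := by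
      rw [sum_range_succ]
      linarith [hnn n]
    have h₂ := sum_le_hasSum (range n) (fun j _ => ht0 j) hT
    have h₃ : 0 ≤ (n : ℝ) * t n := mul_nonneg n.cast_nonneg (ht0 n)
    linarith [hsum n]
  have hlim := hT.tendsto_sum_nat.sub ((tendsto_add_atTop_iff_nat 1).2 hs.hasSum.tendsto_sum_nat)
  simp only [hsum, sub_sub_cancel] at hlim
  have := eq_zero_of_tendsto_nat_mul ht ht0 hT.summable hlim
  rw [sub_eq_zero.1 this]
  exact hs.hasSum

/-- For 0 < p < 2/3, the expected number of rounds until the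
(−1 w.p. p, +2 w.p. 1−p) walk first reaches a strictly positive position is
`(3p + √((3p+1)(1−p)) − 1)/(2p(2−3p))`; in particular for p = 1/2 it is 1 + √5. -/
theorem expected_duration_minus_one_plus_two (p : ℝ) (hp0 : 0 < p) (hp1 : p < 2 / 3) :
    HasSum (fun j : ℕ => (j : ℝ) * a18 p j)
      ((3 * p + Real.sqrt ((3 * p + 1) * (1 - p)) - 1) / (2 * p * (2 - 3 * p))) := by
  have hq : 0 < 1 - p := by linarith
  set S := Real.sqrt ((3 * p + 1) * (1 - p))
  have hS2 : S ^ 2 = (3 * p + 1) * (1 - p) := Real.sq_sqrt (by nlinarith)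
  have hS0 : 0 ≤ S := Real.sqrt_nonneg _
  have hSlow : 1 - p < S := by nlinarith
  have hShigh : S < 3 * (1 - p) := by nlinarith
  obtain ⟨r, hrS⟩ : ∃ r, 2 * (1 - p) * r = p - 1 + S :=
    ⟨(p - 1 + S) / (2 * (1 - p)), by field_simp⟩
  have hr0 : 0 < r := by nlinarith
  have hr1 : r < 1 := by nlinarith
  have hr : (1 - p) * r ^ 2 + (1 - p) * r = p := by
    refine mul_left_cancel₀ (mul_pos four_pos hq).ne' ?_
    linear_combination (2 * (1 - p) * r + S + 1 - p) * hrS + hS2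
  have hc : 1 / ((1 - p) * (1 + r)) = 1 + (1 - p) * (1 / ((1 - p) * (1 + r)) * r ^ 2) := by
    field_simp
    linear_combination -hr
  have hc0 : 0 ≤ 1 / ((1 - p) * (1 + r)) := by positivity
  have hp1' : p < 1 := by linarith
  have hsum := summable_prod_survivalMass hp0.le hp1' hr0.le hr1 hc0 hr hc
  have hval : (3 * p + S - 1) / (2 * p * (2 - 3 * p)) =
      1 / ((1 - p) * (1 + r)) / (1 - r) := by
    have h₁ : 2 - 3 * p ≠ 0 := by linarith
    have h₂ : 1 - r ≠ 0 := by linarith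
    field_simp
    have h₃ : 2 * ((1 - p) * (1 + r) * (1 - r)) = 1 - 3 * p + S := by
      linear_combination hrS - 2 * hr
    linear_combination (3 * p + S - 1) / 2 * h₃ + hS2 / 2
  rw [hval]
  exact hasSum_nat_mul_of_tail (a18_nonneg hp0.le hp1'.le)
    (fun j => tsum_nonneg fun s => survivalMass_nonneg hp0.le hp1'.le j s)
    (fun j => a18_succ_eq_tsum_sub_tsum (hsum.prod_factor j) (hsum.prod_factor (j + 1)))
    (hasSum_tsum_survivalMass hp0.le hp1' hr0.le hr1 hc0 hr hc)
end

section
/- Consider the walk on ℤ starting at 0 which at each round moves −1 or +2, each with probability 1/2, and fix an integer m ≥ 1. For j ≥ 1 let a_{j,m} be the number of words w ∈ {−1, 2}^j whose proper prefix sums are all ≤ m−1 and whose total sum is ≥ m (so a_{j,m}/2^j is the probability of first reaching a position ≥ m at round j). Then the series Σ_{j=1}^∞ j·a_{j,m}/2^j converges and its sum equals 2m + (4 − 2φ) + 2( F_{m+2}·φ − F_{m+3} ), where φ = (1+√5)/2 is the golden ratio and F_i denotes the i-th Fibonacci number (F_0 = 0, F_1 = 1, F_{i+2} = F_{i+1}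 + F_i). -/
/-- `a19 m j` : the number of words `w ∈ {−1,2}^j` whose proper prefix sums are all
`≤ m − 1` and whose total sum is `≥ m`, i.e. histories of a (−1,+2) walk first reaching
a position `≥ m` at round j. -/
def a19 (m j : ℕ) : ℕ :=
  (Finset.univ.filter (fun w : Fin j → ({-1, 2} : Finset ℤ) =>
      (∀ jj : ℕ, jj < j →
        (∑ i ∈ Finset.univ.filter (fun i : Fin j => (i : ℕ) < jj), (w i : ℤ)) ≤ (m : ℤ) - 1) ∧
      (m : ℤ) ≤ ∑ i : Fin j, (w i : ℤ))).card

/-- The number of words in `{-1, 2}^j` whose sum first reaches a value `≥ k` at the last letter. -/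
def firstPassageCount (k : ℤ) (j : ℕ) : ℕ :=
  (Finset.univ.filter (fun w : Fin j → ({-1, 2} : Finset ℤ) =>
      (∀ jj : ℕ, jj < j →
        (∑ i ∈ Finset.univ.filter (fun i : Fin j => (i : ℕ) < jj), (w i : ℤ)) ≤ k - 1) ∧
      k ≤ ∑ i : Fin j, (w i : ℤ))).card

theorem firstPassageCount_zero (k : ℤ) :
    firstPassageCount k 0 = if k ≤ 0 then 1 else 0 := by
  by_cases hk : k ≤ 0 <;> simp [firstPassageCount, hk]

theorem firstPassageCount_succ_of_nonpos {k : ℤ} (hk : k ≤ 0) (j : ℕ) :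
    firstPassageCount k (j + 1) = 0 := by
  rw [firstPassageCount, Finset.card_eq_zero, Finset.filter_eq_empty_iff]
  rintro w - ⟨h, -⟩
  have := h 0 j.succ_pos
  simp at this
  omega

theorem firstPassage_cons_iff {k : ℤ} (hk : 0 < k) {j : ℕ} (a : ({-1, 2} : Finset ℤ))
    (w : Fin j → ({-1, 2} : Finset ℤ)) :
    ((∀ jj : ℕ, jj < j + 1 →
        (∑ i ∈ Finset.univ.filter (fun i : Fin (j + 1) => (i : ℕ) < jj),
          ((Fin.cons a w : Fin (j + 1) → ({-1, 2} : Finset ℤ)) i : ℤ)) ≤ k - 1) ∧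
      k ≤ ∑ i : Fin (j + 1), ((Fin.cons a w : Fin (j + 1) → ({-1, 2} : Finset ℤ)) i : ℤ)) ↔
    ((∀ jj : ℕ, jj < j →
        (∑ i ∈ Finset.univ.filter (fun i : Fin j => (i : ℕ) < jj), (w i : ℤ)) ≤ k - a - 1) ∧
      k - a ≤ ∑ i : Fin j, (w i : ℤ)) := by
  simp only [Finset.sum_filter, Fin.sum_univ_succ, Fin.cons_zero, Fin.cons_succ, Fin.val_zero,
    Fin.val_succ]
  refine and_congr ⟨fun h jj hjj => ?_, fun h jj hjj => ?_⟩ (by omega)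
  · have := h (jj + 1) (by omega)
    simp only [Nat.succ_pos, if_true, Nat.add_lt_add_iff_right] at this
    omega
  · cases jj with
    | zero => simp; omega
    | succ jj =>
      have := h jj (by omega)
      simp only [Nat.succ_pos, if_true, Nat.add_lt_add_iff_right]
      omega

theorem firstPassageCount_succ {k : ℤ} (hk : 0 < k) (j : ℕ) :
    firstPassageCount k (j + 1) = firstPassageCount (k + 1) j + firstPassageCount (k - 2) j := by
  simp only [firstPassageCount, Finset.card_filter]
  rw [← (Fin.consEquiv fun _ => ({-1, 2} : Finset ℤ)).sum_comp, Fintype.sum_prod_type]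
  simp only [Fin.consEquiv_apply, firstPassage_cons_iff hk]
  rw [Finset.sum_coe_sort ({-1, 2} : Finset ℤ) (fun a => ∑ w : Fin j → ({-1, 2} : Finset ℤ),
    if (∀ jj : ℕ, jj < j →
        (∑ i ∈ Finset.univ.filter (fun i : Fin j => (i : ℕ) < jj), (w i : ℤ)) ≤ k - a - 1) ∧
      k - a ≤ ∑ i : Fin j, (w i : ℤ) then 1 else 0), Finset.sum_pair (by norm_num)]
  simp only [sub_neg_eq_add]

/-- The probability that the fair `(-1, +2)` walk first reaches a position `≥ n - 1` at
round `j`. -/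
noncomputable def firstPassageProb (n j : ℕ) : ℝ :=
  (firstPassageCount ((n : ℤ) - 1) j : ℝ) / 2 ^ j

theorem firstPassageProb_nonneg (n j : ℕ) : 0 ≤ firstPassageProb n j := by
  unfold firstPassageProb; positivity

theorem firstPassageProb_of_le_one {n : ℕ} (hn : n ≤ 1) (j : ℕ) :
    firstPassageProb n j = if j = 0 then 1 else 0 := by
  cases j with
  | zero => simp [firstPassageProb, firstPassageCount_zero, hn]
  | succ j =>
    simp [firstPassageProb, firstPassageCount_succ_of_nonpos (k := (n : ℤ) - 1) (by omega)]

theorem firstPassageProb_add_two_zero (n : ℕ) : firstPassageProb (n + 2) 0 = 0 := by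
  simp [firstPassageProb, firstPassageCount_zero]

theorem firstPassageProb_add_two_succ (n j : ℕ) :
    firstPassageProb (n + 2) (j + 1) =
      (firstPassageProb (n + 3) j + firstPassageProb n j) / 2 := by
  have h := firstPassageCount_succ (k := ((n + 2 : ℕ) : ℤ) - 1) (by omega) j
  rw [show ((n + 2 : ℕ) : ℤ) - 1 + 1 = ((n + 3 : ℕ) : ℤ) - 1 by push_cast; ring,
    show ((n + 2 : ℕ) : ℤ) - 1 - 2 = (n : ℤ) - 1 by push_cast; ring] at h
  rw [firstPassageProb, h, Nat.cast_add, pow_succ, firstPassageProb, firstPassageProb]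
  ring

theorem firstPassageProb_le (n j : ℕ) :
    firstPassageProb n j ≤ (4 / 3) ^ n * (91 / 96) ^ j := by
  induction j generalizing n with
  | zero =>
    rcases n with _ | _ | n
    · simp [firstPassageProb_of_le_one]
    · norm_num [firstPassageProb_of_le_one]
    · rw [firstPassageProb_add_two_zero]; positivity
  | succ j ih =>
    rcases n with _ | _ | n
    · simp [firstPassageProb_of_le_one]; positivity
    · simp [firstPassageProb_of_le_one]; positivity
    · rw [firstPassageProb_add_two_succ]
      calc _ ≤ ((4 / 3 : ℝ) ^ (n + 3) * (91 / 96) ^ j + (4 / 3) ^ n * (91 / 96) ^ j) / 2 := by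
            gcongr <;> apply ih
        _ = _ := by ring

/-- A function with at most `(4/3)^n` growth that is harmonic for the `(-1, +2)` walk and vanishes
at the two absorbing sites is zero. -/
theorem eq_zero_of_harmonic_of_growth {d : ℕ → ℝ} {C : ℝ} (h0 : d 0 = 0) (h1 : d 1 = 0)
    (hd : ∀ n, d (n + 2) = (d (n + 3) + d n) / 2) (hC : ∀ n, |d n| ≤ C * (4 / 3) ^ n) (n : ℕ) :
    d n = 0 := by
  have hC0 : 0 ≤ C := by simpa [h0] using hC 0
  have key : ∀ r n, |d n| ≤ C * (4 / 3) ^ n * (91 / 96) ^ r := by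
    intro r
    induction r with
    | zero => simpa using hC
    | succ r ih =>
      rintro (_ | _ | n)
      · simp only [h0, abs_zero]; positivity
      · simp only [zero_add, h1, abs_zero]; positivity
      · rw [hd, abs_div, abs_two]
        calc _ ≤ (|d (n + 3)| + |d n|) / 2 := by gcongr; exact abs_add_le _ _
          _ ≤ (C * (4 / 3) ^ (n + 3) * (91 / 96) ^ r + C * (4 / 3) ^ n * (91 / 96) ^ r) / 2 := by
            gcongr <;> apply ih
          _ = _ := by ring
  have hlim : Filter.Tendsto (fun r : ℕ => C * (4 / 3 : ℝ) ^ n * (91 / 96) ^ r) Filter.atTop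
      (nhds 0) := by
    simpa using (tendsto_pow_atTop_nhds_zero_of_lt_one (r := (91 / 96 : ℝ)) (by norm_num)
      (by norm_num)).const_mul (C * (4 / 3 : ℝ) ^ n)
  exact abs_nonpos_iff.1 (ge_of_tendsto' hlim fun r => key r n)

theorem summable_pow_mul_geometric_ratio (s : ℕ) :
    Summable fun j : ℕ => (j : ℝ) ^ s * (91 / 96) ^ j :=
  summable_pow_mul_geometric_of_norm_lt_one s (by norm_num)

theorem pow_mul_firstPassageProb_le (s n j : ℕ) :
    (j : ℝ) ^ s * firstPassageProb n j ≤ (4 / 3) ^ n * ((j : ℝ) ^ s * (91 / 96) ^ j) := by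
  rw [mul_left_comm]
  gcongr
  exact firstPassageProb_le n j

theorem summable_pow_mul_firstPassageProb (s n : ℕ) :
    Summable fun j : ℕ => (j : ℝ) ^ s * firstPassageProb n j :=
  .of_nonneg_of_le (fun j => mul_nonneg (by positivity) (firstPassageProb_nonneg n j))
    (pow_mul_firstPassageProb_le s n) ((summable_pow_mul_geometric_ratio s).mul_left _)

/-- The `s`-th moment of the first passage time. -/
noncomputable def firstPassageMoment (s n : ℕ) : ℝ :=
  ∑' j : ℕ, (j : ℝ) ^ s * firstPassageProb n j

theorem abs_firstPassageMoment_le (s n : ℕ) :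
    |firstPassageMoment s n| ≤ (∑' j : ℕ, (j : ℝ) ^ s * (91 / 96 : ℝ) ^ j) * (4 / 3) ^ n := by
  rw [firstPassageMoment,
    abs_of_nonneg (tsum_nonneg fun j => mul_nonneg (by positivity) (firstPassageProb_nonneg n j)),
    mul_comm, ← tsum_mul_left]
  exact (summable_pow_mul_firstPassageProb s n).tsum_le_tsum (pow_mul_firstPassageProb_le s n)
    ((summable_pow_mul_geometric_ratio s).mul_left _)

theorem firstPassageMoment_of_le_one {n : ℕ} (hn : n ≤ 1) (s : ℕ) :
    firstPassageMoment s n = 0 ^ s := by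
  simp [firstPassageMoment, firstPassageProb_of_le_one hn]

theorem firstPassageMoment_zero_add_two (n : ℕ) :
    firstPassageMoment 0 (n + 2) = (firstPassageMoment 0 (n + 3) + firstPassageMoment 0 n) / 2 := by
  have h3 := (summable_pow_mul_firstPassageProb 0 (n + 3)).hasSum
  have h0 := (summable_pow_mul_firstPassageProb 0 n).hasSum
  rw [firstPassageMoment, (summable_pow_mul_firstPassageProb 0 (n + 2)).tsum_eq_zero_add,
    firstPassageProb_add_two_zero, mul_zero, zero_add]
  refine (((h3.add h0).div_const 2).congr_fun ?_).tsum_eq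
  intro j
  rw [firstPassageProb_add_two_succ]
  ring

theorem firstPassageMoment_zero (n : ℕ) : firstPassageMoment 0 n = 1 := by
  refine sub_eq_zero.1 (eq_zero_of_harmonic_of_growth (d := fun n => firstPassageMoment 0 n - 1)
    (C := ∑' j : ℕ, (j : ℝ) ^ 0 * (91 / 96 : ℝ) ^ j + 1) ?_ ?_ (fun n => ?_) (fun n => ?_) n)
  · simp [firstPassageMoment_of_le_one]
  · simp [firstPassageMoment_of_le_one]
  · linarith [firstPassageMoment_zero_add_two n]
  · have := abs_firstPassageMoment_le 0 n
    have h1 : (1 : ℝ) ≤ (4 / 3) ^ n := one_le_pow₀ (by norm_num)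
    have := abs_sub (firstPassageMoment 0 n) 1
    rw [abs_one] at this
    linarith

theorem firstPassageMoment_one_add_two (n : ℕ) :
    firstPassageMoment 1 (n + 2) =
      1 + (firstPassageMoment 1 (n + 3) + firstPassageMoment 1 n) / 2 := by
  have h (s n : ℕ) : HasSum (fun j : ℕ => (j : ℝ) ^ s * firstPassageProb n j)
      (firstPassageMoment s n) := (summable_pow_mul_firstPassageProb s n).hasSum
  have hsum := (((h 0 (n + 3)).add (h 0 n)).add ((h 1 (n + 3)).add (h 1 n))).div_const 2
  rw [firstPassageMoment_zero, firstPassageMoment_zero] at hsum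
  rw [firstPassageMoment, (summable_pow_mul_firstPassageProb 1 (n + 2)).tsum_eq_zero_add,
    firstPassageProb_add_two_zero, mul_zero, zero_add]
  refine (hsum.congr_fun ?_).tsum_eq.trans (by ring)
  intro j
  rw [firstPassageProb_add_two_succ]
  push_cast
  ring

theorem abs_fib_mul_goldenRatio_sub_fib_le (n : ℕ) :
    |(Nat.fib n : ℝ) * ((1 + Real.sqrt 5) / 2) - Nat.fib (n + 1)| ≤ 1 := by
  have h := Real.fib_succ_sub_goldenRatio_mul_fib n
  rw [Real.goldenRatio] at h
  rw [abs_sub_comm, mul_comm, h, abs_pow]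
  exact pow_le_one₀ (abs_nonneg _)
    (abs_le.2 ⟨Real.neg_one_lt_goldenConj.le, Real.goldenConj_neg.le.trans zero_le_one⟩)

theorem firstPassageMoment_one (n : ℕ) :
    firstPassageMoment 1 n = 2 * ((n : ℝ) - 1) + (4 - 2 * ((1 + Real.sqrt 5) / 2)) +
      2 * ((Nat.fib (n + 1) : ℝ) * ((1 + Real.sqrt 5) / 2) - (Nat.fib (n + 2) : ℝ)) := by
  refine sub_eq_zero.1 (eq_zero_of_harmonic_of_growth (d := fun n => firstPassageMoment 1 n -
      (2 * ((n : ℝ) - 1) + (4 - 2 * ((1 + Real.sqrt 5) / 2)) +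
      2 * ((Nat.fib (n + 1) : ℝ) * ((1 + Real.sqrt 5) / 2) - (Nat.fib (n + 2) : ℝ))))
    (C := ∑' j : ℕ, (j : ℝ) ^ 1 * (91 / 96 : ℝ) ^ j + 20) ?_ ?_ (fun n => ?_) (fun n => ?_) n)
  · simp [firstPassageMoment_of_le_one]; ring
  · simp [firstPassageMoment_of_le_one, Nat.fib_add_two]; ring
  · simp only [firstPassageMoment_one_add_two n, Nat.fib_add_two (n := n + 3),
      Nat.fib_add_two (n := n + 2), Nat.fib_add_two (n := n + 1)]
    push_cast
    ring
  · have hE := abs_firstPassageMoment_le 1 n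
    have hn : 1 + (n : ℝ) * (1 / 3) ≤ (4 / 3) ^ n :=
      (one_add_mul_le_pow (a := (1 / 3 : ℝ)) (by norm_num) n).trans_eq (by norm_num)
    have h1 : (1 : ℝ) ≤ (4 / 3) ^ n := one_le_pow₀ (by norm_num)
    have hF := abs_le.1 (abs_fib_mul_goldenRatio_sub_fib_le (n + 1))
    have h5 : Real.sqrt 5 ≤ 3 := Real.sqrt_le_iff.2 (by norm_num)
    have h5' := Real.sqrt_nonneg 5
    rw [abs_le] at hE ⊢
    have hn0 : (0 : ℝ) ≤ n := n.cast_nonneg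
    constructor <;> nlinarith

/-- For the fair (−1,+2) walk (each step with probability 1/2), the expected
number of rounds until first reaching a position ≥ m equals
`2m + (4 − 2φ) + 2(F_{m+2}·φ − F_{m+3})`, where φ = (1+√5)/2 and F is the Fibonacci
sequence. -/
theorem expected_duration_two_forward_one_back (m : ℕ) (hm : 1 ≤ m) :
    HasSum (fun j : ℕ => (j : ℝ) * (a19 m j : ℝ) / 2 ^ j)
      (2 * (m : ℝ) + (4 - 2 * ((1 + Real.sqrt 5) / 2)) +
        2 * ((Nat.fib (m + 2) : ℝ) * ((1 + Real.sqrt 5) / 2) - (Nat.fib (m + 3) : ℝ))) := by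
  have h := (summable_pow_mul_firstPassageProb 1 (m + 1)).hasSum
  rw [← firstPassageMoment, firstPassageMoment_one] at h
  convert h using 1
  · funext j
    simp only [firstPassageProb, a19, firstPassageCount, Nat.cast_add, Nat.cast_one,
      add_sub_cancel_right, pow_one, mul_div_assoc]
  · push_cast
    ring
end
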